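/- arXiv:1509.02577 — 2 statements merged into one kernel-verified Lean document; each statement's English description precedes it below -/
import Mathlib

section
/- Let γ > 0 and let H be a 3-graph on n vertices with δ₂(H) ≥ (1/2 − γ)n. Suppose X, Y is a bipartition of V(H) and that the 4-set {x,x',y,y'} spans a copy of K₄³ (the complete 3-graph on 4 vertices) in H with x,x' ∈ X and y,y' ∈ Y. Then at least one of the following holds: (a) the 4-set {x,x',y,y'} is contained in at least γn/4 5-sets of vertices that span (X,Y)-bridges of length 1; (b) (1/2 − 4γ)n ≤ |X|, |Y| ≤ (1/2 + 4γ)n and {x,x',y} is (9γ, X, Y)-typical. -/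
open Finset

/-- `H` is the edge set of a 3-uniform hypergraph (3-graph) on `Fin n`. -/
def Is3Graph (n : ℕ) (H : Finset (Finset (Fin n))) : Prop :=
  ∀ e ∈ H, e.card = 3

/-- `degOn H x y U` : number of `z ∈ U` with `{x,y,z} ∈ H`, i.e. `deg_H(xy, U)`. -/
def degOn {n : ℕ} (H : Finset (Finset (Fin n))) (x y : Fin n) (U : Finset (Fin n)) : ℕ :=
  (U.filter fun z => ({x, y, z} : Finset (Fin n)) ∈ H).card

/-- The minimum codegree `δ₂(H)` is at least `t`. -/
def CodegLB {n : ℕ} (H : Finset (Finset (Fin n))) (t : ℝ) : Prop :=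
  ∀ x y : Fin n, x ≠ y → t ≤ (degOn H x y Finset.univ : ℝ)

/-- `S` spans a copy of `K₄⁻` in `H`: it has 4 vertices and at least 3 of its
four 3-subsets are edges. -/
def SpansK4m {n : ℕ} (H : Finset (Finset (Fin n))) (S : Finset (Fin n)) : Prop :=
  S.card = 4 ∧ 3 ≤ ((S.powersetCard 3).filter (· ∈ H)).card

/-- `S` spans a copy of `K₄³` (the complete 3-graph on 4 vertices) in `H`. -/
def SpansK43 {n : ℕ} (H : Finset (Finset (Fin n))) (S : Finset (Fin n)) : Prop :=
  S.card = 4 ∧ ((S.powersetCard 3).filter (· ∈ H)).card = 4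

/-- The induced subgraph `H[X]` contains a `K₄⁻`-factor. -/
def HasK4mFactorOn {n : ℕ} (H : Finset (Finset (Fin n))) (X : Finset (Fin n)) : Prop :=
  ∃ P : Finset (Finset (Fin n)),
    (∀ S ∈ P, SpansK4m H S) ∧
    (∀ S ∈ P, ∀ T ∈ P, S ≠ T → Disjoint S T) ∧
    P.biUnion id = X

/-- `S` is an `(x,y)`-connector of length `c` in `H`. -/
def IsConnector {n : ℕ} (H : Finset (Finset (Fin n))) (c : ℕ) (x y : Fin n)
    (S : Finset (Fin n)) : Prop :=
  x ∉ S ∧ y ∉ S ∧ S.card = 4 * c - 1 ∧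
    HasK4mFactorOn H (insert x S) ∧ HasK4mFactorOn H (insert y S)

/-- `x` and `y` are `(c,η)`-close in `H` (a 3-graph on `n` vertices). -/
def Close {n : ℕ} (H : Finset (Finset (Fin n))) (c : ℕ) (η : ℝ) (x y : Fin n) : Prop :=
  η * (n : ℝ) ^ (4 * c - 1) ≤ ({S : Finset (Fin n) | IsConnector H c x y S}.ncard : ℝ)

/-- `U` is `(c,η)`-closed in `H`. -/
def ClosedOn {n : ℕ} (H : Finset (Finset (Fin n))) (c : ℕ) (η : ℝ)
    (U : Finset (Fin n)) : Prop :=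
  ∀ x ∈ U, ∀ y ∈ U, x ≠ y → Close H c η x y

/-- The number of `(X,Y)`-bridges `(x,y,S)` of length `c` in `H`. -/
noncomputable def BridgeCount {n : ℕ} (H : Finset (Finset (Fin n))) (c : ℕ)
    (X Y : Finset (Fin n)) : ℕ :=
  {t : Fin n × Fin n × Finset (Fin n) |
    t.1 ∈ X ∧ t.2.1 ∈ Y ∧ IsConnector H c t.1 t.2.1 t.2.2}.ncard

/-- The 3-graph `𝓑[A,B]`: all triples in `A ∪ B` containing an odd number of
vertices of `A`. -/
def BGraph {n : ℕ} (A B : Finset (Fin n)) : Finset (Finset (Fin n)) :=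
  ((A ∪ B).powersetCard 3).filter fun e => (e ∩ A).card % 2 = 1

/-- `H` (a 3-graph on `n` vertices) is `γ`-extremal. -/
def IsExtremal {n : ℕ} (H : Finset (Finset (Fin n))) (γ : ℝ) : Prop :=
  ∃ A B : Finset (Fin n), Disjoint A B ∧ A ∪ B = Finset.univ ∧
    A.card = n / 2 ∧ B.card = n - n / 2 ∧
    ((BGraph A B \ H).card : ℝ) ≤ γ * (n : ℝ) ^ 3

/-- The number of `V₁V₂V₃`-edges of `H`. -/
def eCount {n : ℕ} (H : Finset (Finset (Fin n))) (A B C : Finset (Fin n)) : ℕ :=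
  (H.filter fun e => ∃ a ∈ A, ∃ b ∈ B, ∃ c ∈ C, e = {a, b, c}).card

/-- `Ñ_{c,η}(x)` : the set of vertices `(c,η)`-close to `x` in `H`. -/
def Ntilde {n : ℕ} (H : Finset (Finset (Fin n))) (c : ℕ) (η : ℝ) (x : Fin n) :
    Set (Fin n) :=
  {y | y ≠ x ∧ Close H c η x y}

/-- The triple `{x,x',y}` is `(ρ,X,Y)`-typical. -/
def TypicalTriple {n : ℕ} (H : Finset (Finset (Fin n))) (ρ : ℝ) (X Y : Finset (Fin n))
    (x x' y : Fin n) : Prop :=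
  (Y.card : ℝ) - ρ * n ≤ (degOn H x x' Y : ℝ) ∧
  (((X.filter fun z => ({x, y, z} : Finset (Fin n)) ∈ H ∧
      ({x', y, z} : Finset (Fin n)) ∈ H).card : ℝ) ≤ ρ * n) ∧
  (X.card : ℝ) - ρ * n ≤ (degOn H x y X : ℝ) + (degOn H x' y X : ℝ)

/-- `Q` spans an `(X,Y)`-bridge of length 1, i.e. `Q = {a,b} ∪ S` for some
`(X,Y)`-bridge `(a,b,S)` of length 1. -/
def SpansBridge1 {n : ℕ} (H : Finset (Finset (Fin n))) (X Y Q : Finset (Fin n)) : Prop :=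
  ∃ a ∈ X, ∃ b ∈ Y, ∃ S : Finset (Fin n), IsConnector H 1 a b S ∧
    Q = insert a (insert b S)

theorem aux_card3 {n : ℕ} {p q r : Fin n} (h : ({p, q, r} : Finset (Fin n)).card = 3) :
    p ≠ q ∧ p ≠ r ∧ q ≠ r := by
  refine ⟨?_, ?_, ?_⟩ <;> rintro rfl
  · have := Finset.card_le_two (a := p) (b := r)
    simp at h; omega
  · have := Finset.card_le_two (a := q) (b := p)
    rw [Finset.insert_comm] at h; simp at h; omega
  · have := Finset.card_le_two (a := p) (b := q)
    simp at h; omega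

theorem aux_k4m {n : ℕ} {H : Finset (Finset (Fin n))} (h3 : Is3Graph n H) {p q r z : Fin n}
    (h1 : ({p, q, r} : Finset (Fin n)) ∈ H) (h2 : ({p, q, z} : Finset (Fin n)) ∈ H)
    (h4 : ({p, r, z} : Finset (Fin n)) ∈ H) :
    z ∉ ({p, q, r} : Finset (Fin n)) ∧ SpansK4m H (insert z {p, q, r}) := by
  obtain ⟨a1, a2, a3⟩ := aux_card3 (h3 _ h1)
  obtain ⟨b1, b2, b3⟩ := aux_card3 (h3 _ h2)
  obtain ⟨c1, c2, c3⟩ := aux_card3 (h3 _ h4)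
  have hz : z ∉ ({p, q, r} : Finset (Fin n)) := by
    simp [b2.symm, b3.symm, c3.symm]
  refine ⟨hz, ?_, ?_⟩
  · rw [Finset.card_insert_of_notMem hz, h3 _ h1]
  · have hsub : ({{p, q, r}, {p, q, z}, {p, r, z}} : Finset (Finset (Fin n))) ⊆
        (((insert z {p, q, r} : Finset (Fin n)).powersetCard 3).filter (· ∈ H)) := by
      intro e he
      simp only [Finset.mem_insert, Finset.mem_singleton] at he
      rw [Finset.mem_filter, Finset.mem_powersetCard]
      rcases he with rfl | rfl | rfl
      · exact ⟨⟨by intro w; simp; tauto, h3 _ h1⟩, h1⟩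
      · exact ⟨⟨by intro w; simp; tauto, h3 _ h2⟩, h2⟩
      · exact ⟨⟨by intro w; simp; tauto, h3 _ h4⟩, h4⟩
    have hc : ({{p, q, r}, {p, q, z}, {p, r, z}} : Finset (Finset (Fin n))).card = 3 := by
      rw [Finset.card_eq_three]
      refine ⟨_, _, _, ?_, ?_, ?_, rfl⟩
      · intro h
        have : r ∈ ({p, q, z} : Finset (Fin n)) := by rw [← h]; simp
        simp at this; grind
      · intro h
        have : q ∈ ({p, r, z} : Finset (Fin n)) := by rw [← h]; simp
        simp at this; grind
      · intro h
        have : q ∈ ({p, r, z} : Finset (Fin n)) := by rw [← h]; simp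
        simp at this; grind
    exact hc.symm.le.trans (Finset.card_le_card hsub)

/-- At least two of the pairs of `{p,q,r}` lie in the link of `z`. -/
def AuxTwo {n : ℕ} (H : Finset (Finset (Fin n))) (p q r z : Fin n) : Prop :=
  (({p, q, z} : Finset (Fin n)) ∈ H ∧ ({p, r, z} : Finset (Fin n)) ∈ H) ∨
  (({p, q, z} : Finset (Fin n)) ∈ H ∧ ({q, r, z} : Finset (Fin n)) ∈ H) ∨
  (({p, r, z} : Finset (Fin n)) ∈ H ∧ ({q, r, z} : Finset (Fin n)) ∈ H)

theorem aux_two {n : ℕ} {H : Finset (Finset (Fin n))} (h3 : Is3Graph n H) {p q r z : Fin n}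
    (h1 : ({p, q, r} : Finset (Fin n)) ∈ H) (h : AuxTwo H p q r z) :
    z ∉ ({p, q, r} : Finset (Fin n)) ∧ SpansK4m H (insert z {p, q, r}) := by
  rcases h with ⟨a, b⟩ | ⟨a, b⟩ | ⟨a, b⟩
  · exact aux_k4m h3 h1 a b
  · have e : ({p, q, r} : Finset (Fin n)) = {q, p, r} := by ext; simp; tauto
    have e2 : ({p, q, z} : Finset (Fin n)) = {q, p, z} := by ext; simp; tauto
    rw [e] at h1 ⊢; rw [e2] at a
    exact aux_k4m h3 h1 a b
  · have e : ({p, q, r} : Finset (Fin n)) = {r, p, q} := by ext; simp; tauto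
    have e2 : ({p, r, z} : Finset (Fin n)) = {r, p, z} := by ext; simp; tauto
    have e3 : ({q, r, z} : Finset (Fin n)) = {r, q, z} := by ext; simp; tauto
    rw [e] at h1 ⊢; rw [e2] at a; rw [e3] at b
    exact aux_k4m h3 h1 a b

theorem aux_factor {n : ℕ} {H : Finset (Finset (Fin n))} {S : Finset (Fin n)}
    (h : SpansK4m H S) : HasK4mFactorOn H S :=
  ⟨{S}, by simpa using h, by simp, by simp⟩

theorem aux_conn {n : ℕ} {H : Finset (Finset (Fin n))} (h3 : Is3Graph n H) {p q r v z : Fin n}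
    (h1 : ({p, q, r} : Finset (Fin n)) ∈ H) (h : AuxTwo H p q r z) (hv : AuxTwo H p q r v) :
    IsConnector H 1 z v {p, q, r} := by
  obtain ⟨a, b⟩ := aux_two h3 h1 h
  obtain ⟨c, d⟩ := aux_two h3 h1 hv
  exact ⟨a, c, h3 _ h1, aux_factor b, aux_factor d⟩

theorem aux_conn_symm {n : ℕ} {H : Finset (Finset (Fin n))} {v z : Fin n} {S : Finset (Fin n)}
    (h : IsConnector H 1 z v S) : IsConnector H 1 v z S :=
  ⟨h.2.1, h.1, h.2.2.1, h.2.2.2.2, h.2.2.2.1⟩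

theorem aux_K43 {n : ℕ} {H : Finset (Finset (Fin n))} {S e : Finset (Fin n)}
    (h : SpansK43 H S) (he : e ⊆ S) (hc : e.card = 3) : e ∈ H := by
  obtain ⟨h1, h2⟩ := h
  have : (S.powersetCard 3).filter (· ∈ H) = S.powersetCard 3 := by
    apply Finset.eq_of_subset_of_card_le (Finset.filter_subset _ _)
    rw [h2, Finset.card_powersetCard, h1]; decide
  have h4 : e ∈ (S.powersetCard 3).filter (· ∈ H) := by
    rw [this, Finset.mem_powersetCard]; exact ⟨he, hc⟩
  exact (Finset.mem_filter.1 h4).2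

open Classical in
theorem aux_sum {n : ℕ} (H : Finset (Finset (Fin n))) (x y : Fin n) (U : Finset (Fin n)) :
    (degOn H x y U : ℝ) =
      ∑ z, (if z ∈ U ∧ ({x, y, z} : Finset (Fin n)) ∈ H then (1 : ℝ) else 0) := by
  rw [Finset.sum_boole, degOn]
  congr 2
  ext z; simp

open Classical in
theorem aux_sumU {n : ℕ} (U : Finset (Fin n)) :
    (U.card : ℝ) = ∑ z, (if z ∈ U then (1 : ℝ) else 0) := by
  rw [Finset.sum_boole]
  congr 2
  ext z; simp

open Classical in
theorem aux_p1 (a b c d e f u v : Prop) (h1 : u → ¬ v) (h2 : u ∨ v) :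
    2 * (if a then (1 : ℝ) else 0) + (if b then (1 : ℝ) else 0) + (if c then (1 : ℝ) else 0) + (if d then (1 : ℝ) else 0) + (if e then (1 : ℝ) else 0) ≤ 2 * 1 + 2 * (if v then (1 : ℝ) else 0) + 4 * (if ((u ∧ (((a ∧ b) ∨ (a ∧ c) ∨ (b ∧ c)) ∨ ((a ∧ d) ∨ (a ∧ e) ∨ (d ∧ e)))) ∨
        (v ∧ (((b ∧ d) ∨ (b ∧ f) ∨ (d ∧ f)) ∨ ((c ∧ e) ∨ (c ∧ f) ∨ (e ∧ f))))) then (1 : ℝ) else 0) := by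
  by_cases hu : u
  · have hv := h1 hu
    by_cases ha : a <;> by_cases hb : b <;> by_cases hc : c <;> by_cases hd : d <;>
      by_cases he : e <;> by_cases hf : f <;> simp [hu, hv, ha, hb, hc, hd, he, hf] <;> norm_num
  · have hv := h2.resolve_left hu
    by_cases ha : a <;> by_cases hb : b <;> by_cases hc : c <;> by_cases hd : d <;>
      by_cases he : e <;> by_cases hf : f <;> simp [hu, hv, ha, hb, hc, hd, he, hf] <;> norm_num

open Classical in
theorem aux_p2 (a b c d e f u v : Prop) (h1 : u → ¬ v) (h2 : u ∨ v) :
    2 * (if f then (1 : ℝ) else 0) + (if b then (1 : ℝ) else 0) + (if c then (1 : ℝ) else 0) + (if d then (1 : ℝ) else 0) + (if e then (1 : ℝ) else 0) ≤ 2 * 1 + 2 * (if u then (1 : ℝ) else 0) + 4 * (if ((u ∧ (((a ∧ b) ∨ (a ∧ c) ∨ (b ∧ c)) ∨ ((a ∧ d) ∨ (a ∧ e) ∨ (d ∧ e)))) ∨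
        (v ∧ (((b ∧ d) ∨ (b ∧ f) ∨ (d ∧ f)) ∨ ((c ∧ e) ∨ (c ∧ f) ∨ (e ∧ f))))) then (1 : ℝ) else 0) := by
  by_cases hu : u
  · have hv := h1 hu
    by_cases ha : a <;> by_cases hb : b <;> by_cases hc : c <;> by_cases hd : d <;>
      by_cases he : e <;> by_cases hf : f <;> simp [hu, hv, ha, hb, hc, hd, he, hf] <;> norm_num
  · have hv := h2.resolve_left hu
    by_cases ha : a <;> by_cases hb : b <;> by_cases hc : c <;> by_cases hd : d <;>
      by_cases he : e <;> by_cases hf : f <;> simp [hu, hv, ha, hb, hc, hd, he, hf] <;> norm_num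

open Classical in
theorem aux_p3 (a b c d e f u v : Prop) (h1 : u → ¬ v) (h2 : u ∨ v) :
    (if a then (1 : ℝ) else 0) + (if b then (1 : ℝ) else 0) + (if c then (1 : ℝ) else 0) + (if d then (1 : ℝ) else 0) + (if e then (1 : ℝ) else 0) + (if f then (1 : ℝ) else 0) + (if v then (1 : ℝ) else 0) ≤ 3 * 1 + (if v ∧ a then (1 : ℝ) else 0) + 4 * (if ((u ∧ (((a ∧ b) ∨ (a ∧ c) ∨ (b ∧ c)) ∨ ((a ∧ d) ∨ (a ∧ e) ∨ (d ∧ e)))) ∨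
        (v ∧ (((b ∧ d) ∨ (b ∧ f) ∨ (d ∧ f)) ∨ ((c ∧ e) ∨ (c ∧ f) ∨ (e ∧ f))))) then (1 : ℝ) else 0) := by
  by_cases hu : u
  · have hv := h1 hu
    by_cases ha : a <;> by_cases hb : b <;> by_cases hc : c <;> by_cases hd : d <;>
      by_cases he : e <;> by_cases hf : f <;> simp [hu, hv, ha, hb, hc, hd, he, hf] <;> norm_num
  · have hv := h2.resolve_left hu
    by_cases ha : a <;> by_cases hb : b <;> by_cases hc : c <;> by_cases hd : d <;>
      by_cases he : e <;> by_cases hf : f <;> simp [hu, hv, ha, hb, hc, hd, he, hf] <;> norm_num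

open Classical in
theorem aux_p5 (a b c d e f u v : Prop) (h1 : u → ¬ v) (h2 : u ∨ v) :
    (if a then (1 : ℝ) else 0) + (if b then (1 : ℝ) else 0) + (if c then (1 : ℝ) else 0) + (if d then (1 : ℝ) else 0) + (if e then (1 : ℝ) else 0) + (if f then (1 : ℝ) else 0) + (if u then (1 : ℝ) else 0) ≤ 3 * 1 + ((if u ∧ b then (1 : ℝ) else 0) + (if u ∧ c then (1 : ℝ) else 0)) + 4 * (if ((u ∧ (((a ∧ b) ∨ (a ∧ c) ∨ (b ∧ c)) ∨ ((a ∧ d) ∨ (a ∧ e) ∨ (d ∧ e)))) ∨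
        (v ∧ (((b ∧ d) ∨ (b ∧ f) ∨ (d ∧ f)) ∨ ((c ∧ e) ∨ (c ∧ f) ∨ (e ∧ f))))) then (1 : ℝ) else 0) := by
  by_cases hu : u
  · have hv := h1 hu
    by_cases ha : a <;> by_cases hb : b <;> by_cases hc : c <;> by_cases hd : d <;>
      by_cases he : e <;> by_cases hf : f <;> simp [hu, hv, ha, hb, hc, hd, he, hf] <;> norm_num
  · have hv := h2.resolve_left hu
    by_cases ha : a <;> by_cases hb : b <;> by_cases hc : c <;> by_cases hd : d <;>
      by_cases he : e <;> by_cases hf : f <;> simp [hu, hv, ha, hb, hc, hd, he, hf] <;> norm_num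

set_option maxHeartbeats 4000000 in
/-- a `K₄³`-copy across the bipartition gives many bridges or a
typical triple. -/
theorem stmt_16 (n : ℕ) (γ : ℝ) (hγ : 0 < γ)
    (H : Finset (Finset (Fin n))) (h3 : Is3Graph n H)
    (hδ : CodegLB H ((1 / 2 - γ) * n))
    (X Y : Finset (Fin n)) (hd : Disjoint X Y) (hp : X ∪ Y = Finset.univ)
    (x x' y y' : Fin n) (hx : x ∈ X) (hx' : x' ∈ X) (hy : y ∈ Y) (hy' : y' ∈ Y)
    (hK : SpansK43 H ({x, x', y, y'} : Finset (Fin n))) :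
    (γ * n / 4 ≤ ({Q : Finset (Fin n) | Q.card = 5 ∧
        ({x, x', y, y'} : Finset (Fin n)) ⊆ Q ∧ SpansBridge1 H X Y Q}.ncard : ℝ)) ∨
    ((1 / 2 - 4 * γ) * n ≤ (X.card : ℝ) ∧ (X.card : ℝ) ≤ (1 / 2 + 4 * γ) * n ∧
     (1 / 2 - 4 * γ) * n ≤ (Y.card : ℝ) ∧ (Y.card : ℝ) ≤ (1 / 2 + 4 * γ) * n ∧
     TypicalTriple H (9 * γ) X Y x x' y) := by
  classical
  have hXY : ∀ z, z ∈ X → z ∉ Y := fun z h1 h2 => (Finset.disjoint_left.1 hd) h1 h2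
  have hor : ∀ z, z ∈ X ∨ z ∈ Y := fun z => by
    rw [← Finset.mem_union, hp]; exact Finset.mem_univ z
  have hc4 := hK.1
  have nxy : x ≠ y := fun h => hXY x hx (h ▸ hy)
  have nxy' : x ≠ y' := fun h => hXY x hx (h ▸ hy')
  have nx'y : x' ≠ y := fun h => hXY x' hx' (h ▸ hy)
  have nx'y' : x' ≠ y' := fun h => hXY x' hx' (h ▸ hy')
  have nxx' : x ≠ x' := by
    rintro rfl
    have := Finset.card_le_three (a := x) (b := y) (c := y')
    simp at hc4; omega
  have nyy' : y ≠ y' := by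
    rintro rfl
    have := Finset.card_le_three (a := x) (b := x') (c := y)
    simp at hc4; omega
  have key : ∀ p q r : Fin n, p ∈ ({x, x', y, y'} : Finset (Fin n)) →
      q ∈ ({x, x', y, y'} : Finset (Fin n)) → r ∈ ({x, x', y, y'} : Finset (Fin n)) →
      p ≠ q → p ≠ r → q ≠ r → ({p, q, r} : Finset (Fin n)) ∈ H := by
    intro p q r hp hq hr h1 h2 h4
    apply aux_K43 hK
    · intro w hw
      simp only [Finset.mem_insert, Finset.mem_singleton] at hw
      rcases hw with rfl | rfl | rfl <;> assumption
    · rw [Finset.card_eq_three]; exact ⟨p, q, r, h1, h2, h4, rfl⟩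
  set K : Finset (Fin n) := {x, x', y, y'} with hKdef
  have kx : x ∈ K := by simp [hKdef]
  have kx' : x' ∈ K := by simp [hKdef]
  have ky : y ∈ K := by simp [hKdef]
  have ky' : y' ∈ K := by simp [hKdef]
  let bad : Fin n → Prop := fun z =>
    (z ∈ X ∧ (AuxTwo H x x' y z ∨ AuxTwo H x x' y' z)) ∨
    (z ∈ Y ∧ (AuxTwo H x y y' z ∨ AuxTwo H x' y y' z))
  let B : Finset (Fin n) := Finset.univ.filter bad
  have hBK : ∀ z ∈ B, z ∉ K ∧ SpansBridge1 H X Y (insert z K) := by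
    intro z hz
    have hz' : bad z := (Finset.mem_filter.1 hz).2
    rcases hz' with ⟨hzX, h | h⟩ | ⟨hzY, h | h⟩
    · have e := key x x' y kx kx' ky nxx' nxy nx'y
      have hn := (aux_two h3 e h).1
      have hzv : z ≠ y' := fun hh => hXY z hzX (hh ▸ hy')
      refine ⟨by simp [hKdef] at hn ⊢; tauto, z, hzX, y', hy', {x, x', y}, ?_, ?_⟩
      · exact aux_conn h3 e h (Or.inl ⟨key _ _ _ kx kx' ky' nxx' nxy' nx'y',
          key _ _ _ kx ky ky' nxy nxy' nyy'⟩)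
      · rw [hKdef]; ext w; simp; tauto
    · have e := key x x' y' kx kx' ky' nxx' nxy' nx'y'
      have hn := (aux_two h3 e h).1
      have hzv : z ≠ y := fun hh => hXY z hzX (hh ▸ hy)
      refine ⟨by simp [hKdef] at hn ⊢; tauto, z, hzX, y, hy, {x, x', y'}, ?_, ?_⟩
      · exact aux_conn h3 e h (Or.inl ⟨key _ _ _ kx kx' ky nxx' nxy nx'y,
          key _ _ _ kx ky' ky nxy' nxy nyy'.symm⟩)
      · rw [hKdef]; ext w; simp; tauto
    · have e := key x y y' kx ky ky' nxy nxy' nyy'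
      have hn := (aux_two h3 e h).1
      have hzv : z ≠ x' := fun hh => hXY x' hx' (hh ▸ hzY)
      refine ⟨by simp [hKdef] at hn ⊢; tauto, x', hx', z, hzY, {x, y, y'}, ?_, ?_⟩
      · exact aux_conn_symm (aux_conn h3 e h (Or.inl ⟨key _ _ _ kx ky kx' nxy nxx' nx'y.symm,
          key _ _ _ kx ky' kx' nxy' nxx' nx'y'.symm⟩))
      · rw [hKdef]; ext w; simp; tauto
    · have e := key x' y y' kx' ky ky' nx'y nx'y' nyy'
      have hn := (aux_two h3 e h).1
      have hzv : z ≠ x := fun hh => hXY x hx (hh ▸ hzY)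
      refine ⟨by simp [hKdef] at hn ⊢; tauto, x, hx, z, hzY, {x', y, y'}, ?_, ?_⟩
      · exact aux_conn_symm (aux_conn h3 e h (Or.inl ⟨key _ _ _ kx' ky kx nx'y nxx'.symm nxy.symm,
          key _ _ _ kx' ky' kx nx'y' nxx'.symm nxy'.symm⟩))
      · rw [hKdef]; ext w; simp; tauto
  have hBcard : B.card ≤ {Q : Finset (Fin n) | Q.card = 5 ∧ K ⊆ Q ∧ SpansBridge1 H X Y Q}.ncard := by
    have hinj : Set.InjOn (fun z => insert z K) (B : Set (Fin n)) := by
      intro a ha b hb hab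
      have h1 := (hBK a ha).1
      have h2 : a ∈ insert b K := by
        have : a ∈ insert a K := Finset.mem_insert_self _ _
        simpa only [hab] using (show insert a K = insert b K from hab) ▸ this
      rcases Finset.mem_insert.1 h2 with h | h
      · exact h
      · exact absurd h h1
    rw [← Finset.card_image_of_injOn hinj, ← Set.ncard_coe_finset]
    apply Set.ncard_le_ncard _ (Set.toFinite _)
    intro Q hQ
    simp only [Finset.coe_image, Set.mem_image, Finset.mem_coe] at hQ
    obtain ⟨z, hz, rfl⟩ := hQ
    obtain ⟨h1, h2⟩ := hBK z hz
    exact ⟨by rw [Finset.card_insert_of_notMem h1, hc4], Finset.subset_insert _ _, h2⟩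
  by_cases hBn : γ * n / 4 ≤ (B.card : ℝ)
  · left
    exact hBn.trans (by exact_mod_cast hBcard)
  right
  push Not at hBn
  have hn1 : (X.card : ℝ) + Y.card = n := by
    have := Finset.card_union_of_disjoint hd
    rw [hp, Finset.card_univ, Fintype.card_fin] at this
    exact_mod_cast this.symm
  have hnn : (n : ℝ) = ∑ z : Fin n, (1 : ℝ) := by simp
  have D1 := hδ x x' nxx'
  have D2 := hδ x y nxy
  have D3 := hδ x' y nx'y
  have D4 := hδ x y' nxy'
  have D5 := hδ x' y' nx'y'
  have D6 := hδ y y' nyy'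
  have bB : ∀ z, z ∈ B ↔ bad z := fun z => by simp [B]
  have I1 : 2 * (degOn H x x' univ : ℝ) + degOn H x y univ + degOn H x' y univ
      + degOn H x y' univ + degOn H x' y' univ ≤ 2 * (n : ℝ) + 2 * Y.card + 4 * B.card := by
    simp only [aux_sum, aux_sumU, hnn, Finset.mul_sum, ← Finset.sum_add_distrib]
    apply Finset.sum_le_sum
    intro z _
    have h1 := hXY z; have h2 := hor z
    simp only [bB, bad, AuxTwo, Finset.mem_univ, true_and]
    have h5 := aux_p1
      (({x, x', z} : Finset (Fin n)) ∈ H)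
      (({x, y, z} : Finset (Fin n)) ∈ H)
      (({x', y, z} : Finset (Fin n)) ∈ H)
      (({x, y', z} : Finset (Fin n)) ∈ H)
      (({x', y', z} : Finset (Fin n)) ∈ H)
      (({y, y', z} : Finset (Fin n)) ∈ H)
      (z ∈ X) (z ∈ Y) h1 h2
    convert h5
    rfl
  have I2 : 2 * (degOn H y y' univ : ℝ) + degOn H x y univ + degOn H x' y univ
      + degOn H x y' univ + degOn H x' y' univ ≤ 2 * (n : ℝ) + 2 * X.card + 4 * B.card := by
    simp only [aux_sum, aux_sumU, hnn, Finset.mul_sum, ← Finset.sum_add_distrib]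
    apply Finset.sum_le_sum
    intro z _
    have h1 := hXY z; have h2 := hor z
    simp only [bB, bad, AuxTwo, Finset.mem_univ, true_and]
    have h5 := aux_p2
      (({x, x', z} : Finset (Fin n)) ∈ H)
      (({x, y, z} : Finset (Fin n)) ∈ H)
      (({x', y, z} : Finset (Fin n)) ∈ H)
      (({x, y', z} : Finset (Fin n)) ∈ H)
      (({x', y', z} : Finset (Fin n)) ∈ H)
      (({y, y', z} : Finset (Fin n)) ∈ H)
      (z ∈ X) (z ∈ Y) h1 h2
    convert h5
    rfl
  have I3 : (degOn H x x' univ : ℝ) + degOn H x y univ + degOn H x' y univ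
      + degOn H x y' univ + degOn H x' y' univ + degOn H y y' univ + Y.card
      ≤ 3 * (n : ℝ) + degOn H x x' Y + 4 * B.card := by
    simp only [aux_sum, aux_sumU, hnn, Finset.mul_sum, ← Finset.sum_add_distrib]
    apply Finset.sum_le_sum
    intro z _
    have h1 := hXY z; have h2 := hor z
    simp only [bB, bad, AuxTwo, Finset.mem_univ, true_and]
    have h5 := aux_p3
      (({x, x', z} : Finset (Fin n)) ∈ H)
      (({x, y, z} : Finset (Fin n)) ∈ H)
      (({x', y, z} : Finset (Fin n)) ∈ H)
      (({x, y', z} : Finset (Fin n)) ∈ H)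
      (({x', y', z} : Finset (Fin n)) ∈ H)
      (({y, y', z} : Finset (Fin n)) ∈ H)
      (z ∈ X) (z ∈ Y) h1 h2
    convert h5
    rfl
  have I5 : (degOn H x x' univ : ℝ) + degOn H x y univ + degOn H x' y univ
      + degOn H x y' univ + degOn H x' y' univ + degOn H y y' univ + X.card
      ≤ 3 * (n : ℝ) + (degOn H x y X + degOn H x' y X) + 4 * B.card := by
    simp only [aux_sum, aux_sumU, hnn, Finset.mul_sum, ← Finset.sum_add_distrib]
    apply Finset.sum_le_sum
    intro z _
    have h1 := hXY z; have h2 := hor z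
    simp only [bB, bad, AuxTwo, Finset.mem_univ, true_and]
    have h5 := aux_p5
      (({x, x', z} : Finset (Fin n)) ∈ H)
      (({x, y, z} : Finset (Fin n)) ∈ H)
      (({x', y, z} : Finset (Fin n)) ∈ H)
      (({x, y', z} : Finset (Fin n)) ∈ H)
      (({x', y', z} : Finset (Fin n)) ∈ H)
      (({y, y', z} : Finset (Fin n)) ∈ H)
      (z ∈ X) (z ∈ Y) h1 h2
    convert h5
    rfl
  have I4 : ((X.filter fun z => ({x, y, z} : Finset (Fin n)) ∈ H ∧
      ({x', y, z} : Finset (Fin n)) ∈ H).card : ℝ) ≤ B.card := by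
    have : (X.filter fun z => ({x, y, z} : Finset (Fin n)) ∈ H ∧
      ({x', y, z} : Finset (Fin n)) ∈ H) ⊆ B := by
      intro z hz
      obtain ⟨h1, h2, h4⟩ := Finset.mem_filter.1 hz
      exact (bB z).2 (Or.inl ⟨h1, Or.inl (Or.inr (Or.inr ⟨h2, h4⟩))⟩)
    exact_mod_cast Finset.card_le_card this
  have hγn : 0 ≤ γ * n := by positivity
  refine ⟨?_, ?_, ?_, ?_, ?_, ?_, ?_⟩ <;> linarith
end

section
/- Whenever constants satisfy the hierarchy 0 < 1/n ≪ ε' ≪ ε ≪ η ≪ γ ≤ ρ ≪ 1/c, the following holds: let H be a 3-graph on n vertices with δ₂(H) ≥ (1/2 − γ)n and let X, Y be a partition of V(H) with (1/2 − ρ)n ≤ |X| ≤ (1/2 + ρ)n. Assume X = V_{i₁} ∪ V_{i₂} and Y = V_{i₃} ∪ V_{i₄} where (1) either V_{i₁} = V_{i₂} or V_{i₁} ∩ V_{i₂} = ∅, and either V_{i₃} = V_{i₄} or V_{i₃} ∩ V_{i₄} = ∅, and (2) each V_{i_j} is (c,η)-closed in H and has size at least (1/4 − 4γ)n. Suppose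 there are at least εn⁴ copies {x,x',y,y'} of K₄⁻ in H with x,x' ∈ X, y ∈ V_{i₃}, y' ∈ V_{i₄}, and {x,x',y} (ρ,X,Y)-typical. Then at least one of the following holds: (a) there are at least ε'n^{4c+5} (X,Y)-bridges of length c+1 in H; (b) V_{i₁} ∩ V_{i₂} = ∅ and there are at least ε'n⁵ (V_{i₁},V_{i₂})-bridges of length 1 in H. -/
open Finset

/-! ### Basic indicators -/

open Classical in
/-- indicator of an edge -/
noncomputable def hh {n : ℕ} (H : Finset (Finset (Fin n))) (a b c : Fin n) : ℝ :=
  if ({a, b, c} : Finset (Fin n)) ∈ H then 1 else 0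

open Classical in
/-- indicator of an (unordered) `K₄⁻` -/
noncomputable def kk {n : ℕ} (H : Finset (Finset (Fin n))) (a b c d : Fin n) : ℝ :=
  if SpansK4m H {a, b, c, d} then 1 else 0

open Classical in
/-- indicator of a bridge of length one -/
noncomputable def bb {n : ℕ} (H : Finset (Finset (Fin n))) (X Y : Finset (Fin n))
    (a b u v p : Fin n) : ℝ :=
  if a ∈ X ∧ b ∈ Y ∧ SpansK4m H {a, u, v, p} ∧ SpansK4m H {b, u, v, p} then 1 else 0

section basics
variable {n : ℕ} {H : Finset (Finset (Fin n))} {X Y : Finset (Fin n)}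

lemma hh01 (a b c : Fin n) : hh H a b c = 0 ∨ hh H a b c = 1 := by
  unfold hh; split_ifs <;> simp

lemma hh_nonneg (a b c : Fin n) : 0 ≤ hh H a b c := by
  rcases hh01 (H := H) a b c with h | h <;> rw [h] <;> norm_num

lemma hh_le (a b c : Fin n) : hh H a b c ≤ 1 := by
  rcases hh01 (H := H) a b c with h | h <;> rw [h] <;> norm_num

lemma hh_mem {a b c : Fin n} (h : hh H a b c = 1) : ({a, b, c} : Finset (Fin n)) ∈ H := by
  unfold hh at h; split_ifs at h with h1
  · exact h1
  · norm_num at h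

lemma hh_swap12 (a b c : Fin n) : hh H a b c = hh H b a c := by
  unfold hh
  have : ({a, b, c} : Finset (Fin n)) = {b, a, c} := by ext; simp; tauto
  rw [this]

lemma hh_swap23 (a b c : Fin n) : hh H a b c = hh H a c b := by
  unfold hh
  have : ({a, b, c} : Finset (Fin n)) = {a, c, b} := by ext; simp; tauto
  rw [this]

lemma kk_nonneg (a b c d : Fin n) : 0 ≤ kk H a b c d := by
  unfold kk; split_ifs <;> norm_num

lemma bb_nonneg (a b c d e : Fin n) : 0 ≤ bb H X Y a b c d e := by
  unfold bb; split_ifs <;> norm_num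

lemma hh_ne (h3 : Is3Graph n H) {a b c : Fin n} (h : hh H a b c = 1) :
    a ≠ b ∧ a ≠ c ∧ b ≠ c := by
  have := h3 _ (hh_mem h)
  exact Finset.card_eq_three.mp this |> fun _ => by
    refine ⟨?_, ?_, ?_⟩
    · rintro rfl
      have h2 : ({a, a, c} : Finset (Fin n)).card ≤ 2 := by
        rw [Finset.insert_idem]; exact Finset.card_le_two
      omega
    · rintro rfl
      have h2 : ({a, b, a} : Finset (Fin n)).card ≤ 2 := by
        have : ({a, b, a} : Finset (Fin n)) = {a, b} := by ext; simp; tauto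
        rw [this]; exact Finset.card_le_two
      omega
    · rintro rfl
      have h2 : ({a, b, b} : Finset (Fin n)).card ≤ 2 := by
        have : ({a, b, b} : Finset (Fin n)) = {a, b} := by ext; simp
        rw [this]; exact Finset.card_le_two
      omega

/-- three edges through `a` span a `K₄⁻`. -/
lemma spans_of (h3 : Is3Graph n H) {a b c d : Fin n} (h1 : hh H a b c = 1)
    (h2 : hh H a b d = 1) (h4 : hh H a c d = 1) : SpansK4m H {a, b, c, d} := by
  obtain ⟨n1, n2, n3⟩ := hh_ne h3 h1
  obtain ⟨m1, m2, m3⟩ := hh_ne h3 h2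
  obtain ⟨k1, k2, k3⟩ := hh_ne h3 h4
  have hc : ({a, b, c, d} : Finset (Fin n)).card = 4 := by
    rw [Finset.card_insert_of_notMem, Finset.card_insert_of_notMem,
      Finset.card_insert_of_notMem, Finset.card_singleton] <;> simp <;> tauto
  refine ⟨hc, ?_⟩
  have hsub : ({{a, b, c}, {a, b, d}, {a, c, d}} : Finset (Finset (Fin n))) ⊆
      ((({a, b, c, d} : Finset (Fin n)).powersetCard 3).filter (· ∈ H)) := by
    intro e he
    simp only [Finset.mem_insert, Finset.mem_singleton] at he
    rw [Finset.mem_filter, Finset.mem_powersetCard]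
    rcases he with rfl | rfl | rfl
    · refine ⟨⟨?_, h3 _ (hh_mem h1)⟩, hh_mem h1⟩
      intro t; simp; tauto
    · refine ⟨⟨?_, h3 _ (hh_mem h2)⟩, hh_mem h2⟩
      intro t; simp; tauto
    · refine ⟨⟨?_, h3 _ (hh_mem h4)⟩, hh_mem h4⟩
      intro t; simp; tauto
  have h3c : ({{a, b, c}, {a, b, d}, {a, c, d}} : Finset (Finset (Fin n))).card = 3 := by
    rw [Finset.card_eq_three]
    refine ⟨_, _, _, ?_, ?_, ?_, rfl⟩
    · intro h
      have : d ∈ ({a, b, c} : Finset (Fin n)) := by rw [h]; simp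
      simp at this; grind
    · intro h
      have : d ∈ ({a, b, c} : Finset (Fin n)) := by rw [h]; simp
      simp at this; grind
    · intro h
      have : b ∈ ({a, c, d} : Finset (Fin n)) := by rw [← h]; simp
      simp at this; grind
  calc 3 = _ := h3c.symm
    _ ≤ _ := Finset.card_le_card hsub

lemma kk_of (h3 : Is3Graph n H) {a b c d : Fin n} (h1 : hh H a b c = 1)
    (h2 : hh H a b d = 1) (h4 : hh H a c d = 1) : kk H a b c d = 1 := by
  unfold kk; rw [if_pos (spans_of h3 h1 h2 h4)]

lemma kk_spans {a b c d : Fin n} (h : kk H a b c d = 1) : SpansK4m H {a, b, c, d} := by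
  unfold kk at h; split_ifs at h with h1
  · exact h1
  · norm_num at h

lemma kk_rot (a b c d : Fin n) : kk H a b c d = kk H b c d a := by
  unfold kk
  have : ({a, b, c, d} : Finset (Fin n)) = {b, c, d, a} := by ext; simp; tauto
  rw [this]

lemma kk_swap (a b c d : Fin n) : kk H a b c d = kk H b a c d := by
  unfold kk
  have : ({a, b, c, d} : Finset (Fin n)) = {b, a, c, d} := by ext; simp; tauto
  rw [this]

lemma bb_of {a b u v p : Fin n} (ha : a ∈ X) (hb : b ∈ Y) (h1 : kk H a u v p = 1)
    (h2 : kk H b u v p = 1) : bb H X Y a b u v p = 1 := by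
  unfold bb; rw [if_pos ⟨ha, hb, kk_spans h1, kk_spans h2⟩]

lemma codeg_sum (hXY : Disjoint X Y) (hU : X ∪ Y = Finset.univ) {t : ℝ} (hd : CodegLB H t)
    {a b : Fin n} (hab : a ≠ b) : t ≤ ∑ z ∈ X, hh H a b z + ∑ z ∈ Y, hh H a b z := by
  have := hd a b hab
  rw [← Finset.sum_union hXY, hU]
  unfold degOn at this
  rw [Finset.card_filter] at this
  push_cast at this
  convert this using 2
  unfold hh; split_ifs <;> rfl

end basics

/-! ### Triangle counting -/

lemma tri_identity {V : Type*} (Y : Finset V) (g : V → V → ℝ)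
    (gs : ∀ a b, g a b = g b a) :
    ∑ y ∈ Y, ∑ w ∈ Y, ∑ v ∈ Y, g y w * (1 - g y v) * (1 - g w v) =
      (∑ y ∈ Y, ∑ w ∈ Y, g y w) * Y.card - 2 * ∑ y ∈ Y, (∑ w ∈ Y, g y w) ^ 2
      + ∑ y ∈ Y, ∑ w ∈ Y, ∑ v ∈ Y, g y w * g y v * g w v := by
  have e1 : ∑ y ∈ Y, ∑ w ∈ Y, ∑ v ∈ Y, g y w * g y v = ∑ y ∈ Y, (∑ w ∈ Y, g y w) ^ 2 := by
    refine Finset.sum_congr rfl fun y _ => ?_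
    rw [sq, Finset.sum_mul_sum]
  have e2 : ∑ y ∈ Y, ∑ w ∈ Y, ∑ v ∈ Y, g y w * g w v = ∑ y ∈ Y, (∑ w ∈ Y, g y w) ^ 2 := by
    rw [Finset.sum_comm, ← e1]
    refine Finset.sum_congr rfl fun y _ => Finset.sum_congr rfl fun w _ =>
      Finset.sum_congr rfl fun v _ => ?_
    rw [gs w y]
  have e3 : ∑ y ∈ Y, ∑ w ∈ Y, ∑ v ∈ Y, g y w = (∑ y ∈ Y, ∑ w ∈ Y, g y w) * Y.card := by
    rw [Finset.sum_mul]
    refine Finset.sum_congr rfl fun y _ => ?_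
    rw [Finset.sum_mul]
    refine Finset.sum_congr rfl fun w _ => ?_
    simp [mul_comm]
  rw [← e3, two_mul]
  nth_rewrite 1 [← e1]
  rw [← e2]
  simp only [← Finset.sum_add_distrib, ← Finset.sum_sub_distrib]
  refine Finset.sum_congr rfl fun y _ => Finset.sum_congr rfl fun w _ =>
      Finset.sum_congr rfl fun v _ => ?_
  ring

lemma tri_bound {V : Type*} (Y : Finset V) (g : V → V → ℝ)
    (gs : ∀ a b, g a b = g b a) (T : ℝ)
    (hT : ∑ y ∈ Y, ∑ w ∈ Y, ∑ v ∈ Y, g y w * g y v * g w v ≤ T) :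
    (Y.card : ℝ) * ∑ y ∈ Y, ∑ w ∈ Y, ∑ v ∈ Y, g y w * (1 - g y v) * (1 - g w v) ≤
      (∑ y ∈ Y, ∑ w ∈ Y, g y w) * (Y.card : ℝ) ^ 2 - 2 * (∑ y ∈ Y, ∑ w ∈ Y, g y w) ^ 2
      + Y.card * T := by
  rw [tri_identity Y g gs]
  have := sq_sum_le_card_mul_sum_sq (s := Y) (f := fun y => ∑ w ∈ Y, g y w)
  have h2 : (Y.card : ℝ) * (∑ y ∈ Y, ∑ w ∈ Y, ∑ v ∈ Y, g y w * g y v * g w v) ≤ Y.card * T :=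
    mul_le_mul_of_nonneg_left hT (by positivity)
  nlinarith

/-! ### The core argument -/

section core
variable {n : ℕ} {H : Finset (Finset (Fin n))} {X Y : Finset (Fin n)}

lemma real_aux1 {a b c s t β : ℝ} (ha : a = 0 ∨ a = 1) (hb : b = 0 ∨ b = 1) (hc : c = 0 ∨ c = 1)
    (hs : s = 0 ∨ s = 1) (ht : t = 0 ∨ t = 1) (hβ : 0 ≤ β)
    (h : a = 1 → b = 1 → c = 1 → s = 1 → t = 1 → β = 1) :
    a * b * c ≤ β + (1 - s) + (1 - t) := by
  rcases ha with rfl | rfl <;> rcases hb with rfl | rfl <;> rcases hc with rfl | rfl <;>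
    rcases hs with rfl | rfl <;> rcases ht with rfl | rfl <;> norm_num <;> try linarith
  have := h rfl rfl rfl rfl rfl
  linarith

lemma sum3_bound {V : Type*} (Y : Finset V) (f b : V → V → V → ℝ) (t : V → ℝ) {σ N : ℝ}
    (hY : (Y.card : ℝ) ≤ N) (hσ : 0 ≤ σ)
    (ht : ∑ y ∈ Y, (1 - t y) ≤ σ * N)
    (hb : ∑ y ∈ Y, ∑ w ∈ Y, ∑ v ∈ Y, b y w v ≤ σ * N ^ 3)
    (hf : ∀ y ∈ Y, ∀ w ∈ Y, ∀ v ∈ Y, f y w v ≤ b y w v + (1 - t y) + (1 - t w)) :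
    ∑ y ∈ Y, ∑ w ∈ Y, ∑ v ∈ Y, f y w v ≤ 3 * σ * N ^ 3 := by
  have hN : 0 ≤ N := le_trans (by positivity) hY
  have h1 : ∑ y ∈ Y, ∑ w ∈ Y, ∑ v ∈ Y, f y w v ≤
      ∑ y ∈ Y, ∑ w ∈ Y, ∑ v ∈ Y, (b y w v + (1 - t y) + (1 - t w)) :=
    Finset.sum_le_sum fun y hy => Finset.sum_le_sum fun w hw => Finset.sum_le_sum fun v hv =>
      hf y hy w hw v hv
  have h2 : ∑ y ∈ Y, ∑ w ∈ Y, ∑ v ∈ Y, (b y w v + (1 - t y) + (1 - t w)) =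
      ∑ y ∈ Y, ∑ w ∈ Y, ∑ v ∈ Y, b y w v + (Y.card : ℝ) ^ 2 * ∑ y ∈ Y, (1 - t y)
        + (Y.card : ℝ) ^ 2 * ∑ y ∈ Y, (1 - t y) := by
    simp only [Finset.sum_add_distrib, Finset.sum_const, nsmul_eq_mul, ← Finset.mul_sum]
    ring
  have h3 : (Y.card : ℝ) ^ 2 * ∑ y ∈ Y, (1 - t y) ≤ N ^ 2 * (σ * N) := by
    calc _ ≤ (Y.card : ℝ) ^ 2 * (σ * N) := mul_le_mul_of_nonneg_left ht (by positivity)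
      _ ≤ _ := mul_le_mul_of_nonneg_right (by gcongr) (by positivity)
  nlinarith

lemma tri_few (h3 : Is3Graph n H) {x x' : Fin n} (hx' : x' ∈ X) {σ N : ℝ}
    (hY : (Y.card : ℝ) ≤ N) (hσ : 0 ≤ σ)
    (ht : ∑ y ∈ Y, (1 - hh H x x' y) ≤ σ * N)
    (hb : ∑ y ∈ Y, ∑ w ∈ Y, ∑ v ∈ Y, bb H X Y x' v x y w ≤ σ * N ^ 3) :
    ∑ y ∈ Y, ∑ w ∈ Y, ∑ v ∈ Y, hh H x y w * hh H x y v * hh H x w v ≤ 3 * σ * N ^ 3 := by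
  refine sum3_bound Y _ (fun y w v => bb H X Y x' v x y w) (fun y => hh H x x' y) hY hσ ht hb ?_
  intro y hy w hw v hv
  refine real_aux1 (hh01 _ _ _) (hh01 _ _ _) (hh01 _ _ _) (hh01 _ _ _) (hh01 _ _ _)
    (bb_nonneg _ _ _ _ _) ?_
  intro e1 e2 e3 e4 e5
  refine bb_of hx' hv ?_ ?_
  · rw [kk_swap]; exact kk_of h3 e4 e5 e1
  · rw [kk_rot]; exact kk_of h3 e1 e2 e3

lemma path_few (h3 : Is3Graph n H) {x x' : Fin n} (hx' : x' ∈ X) {σ N : ℝ}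
    (hY : (Y.card : ℝ) ≤ N) (hσ : 0 ≤ σ)
    (ht : ∑ y ∈ Y, (1 - hh H x x' y) ≤ σ * N)
    (hb : ∑ y ∈ Y, ∑ w ∈ Y, ∑ v ∈ Y, bb H X Y x' v x y w ≤ σ * N ^ 3) :
    ∑ y ∈ Y, ∑ w ∈ Y, ∑ v ∈ Y, hh H x y w * hh H x y v * hh H y w v ≤ 3 * σ * N ^ 3 := by
  refine sum3_bound Y _ (fun y w v => bb H X Y x' v x y w) (fun y => hh H x x' y) hY hσ ht hb ?_
  intro y hy w hw v hv
  refine real_aux1 (hh01 _ _ _) (hh01 _ _ _) (hh01 _ _ _) (hh01 _ _ _) (hh01 _ _ _)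
    (bb_nonneg _ _ _ _ _) ?_
  intro e1 e2 e3 e4 e5
  refine bb_of hx' hv ?_ ?_
  · rw [kk_swap]; exact kk_of h3 e4 e5 e1
  · rw [kk_rot, kk_swap]
    rw [hh_swap12] at e1 e2
    exact kk_of h3 e1 e2 e3

/-- upper bound on the number of edges of the link of `x` inside `Y` -/
lemma e_upper {e m N σ : ℝ} (hN : 0 < N) (hσ : 0 < σ) (hσ1 : σ ≤ 1 / 1000000)
    (hm0 : 0 ≤ m)
    (hm : m ≤ (1 / 2 + σ) * N) (h : 0 ≤ e * m ^ 2 - 2 * e ^ 2 + m * (3 * σ * N ^ 3)) :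
    e ≤ (1 / 8 + 10 * σ) * N ^ 2 := by
  by_contra hlt
  push Not at hlt
  obtain ⟨t, rfl⟩ : ∃ t, e = t * N ^ 2 := ⟨e / N ^ 2, by field_simp⟩
  obtain ⟨r, rfl⟩ : ∃ r, m = r * N := ⟨m / N, by field_simp⟩
  have hr : r ≤ 1 / 2 + σ := le_of_mul_le_mul_right hm hN
  have hr0 : 0 ≤ r := by by_contra hh; push Not at hh; nlinarith
  have ht : 1 / 8 + 10 * σ < t := lt_of_mul_lt_mul_right hlt (by positivity)
  have h' : 0 ≤ N ^ 4 * (t * r ^ 2 - 2 * t ^ 2 + r * (3 * σ)) := by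
    have : N ^ 4 * (t * r ^ 2 - 2 * t ^ 2 + r * (3 * σ)) = t * N ^ 2 * (r * N) ^ 2 - 2 * (t * N ^ 2) ^ 2 + r * N * (3 * σ * N ^ 3) := by ring
    rw [this]; exact h
  have h2 : 0 ≤ t * r ^ 2 - 2 * t ^ 2 + r * (3 * σ) :=
    nonneg_of_mul_nonneg_right h' (by positivity)
  have hr2 : r ^ 2 ≤ 1 / 4 + 1.1 * σ := by nlinarith
  have hr3 : r * (3 * σ) ≤ 1.6 * σ := by nlinarith
  have h5 : t * r ^ 2 ≤ t * (1 / 4 + 1.1 * σ) := mul_le_mul_of_nonneg_left hr2 (by linarith)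
  have h6 : 0 ≤ t * (t - (1 / 8 + 10 * σ)) := mul_nonneg (by linarith) (by linarith)
  have h7 : 0 ≤ σ * (t - 1 / 8) := mul_nonneg hσ.le (by linarith)
  nlinarith


lemma kk_perm {a b c d a' b' c' d' : Fin n} (h : kk H a b c d = 1)
    (e : ({a, b, c, d} : Finset (Fin n)) = {a', b', c', d'}) : kk H a' b' c' d' = 1 := by
  unfold kk at *; rwa [e] at h

lemma hh_perm {a b c a' b' c' : Fin n} (h : hh H a b c = 1)
    (e : ({a, b, c} : Finset (Fin n)) = {a', b', c'}) : hh H a' b' c' = 1 := by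
  unfold hh at *; rwa [e] at h

lemma hh_perm' {a b c a' b' c' : Fin n}
    (e : ({a, b, c} : Finset (Fin n)) = {a', b', c'}) : hh H a b c = hh H a' b' c' := by
  unfold hh; rw [e]

lemma real_aux3 {a g h k u β : ℝ} (ha : a = 0 ∨ a = 1) (hg : g = 0 ∨ g = 1) (hh : h = 0 ∨ h = 1)
    (hk : k = 0 ∨ k = 1) (hu : u = 0 ∨ u = 1) (hβ : 0 ≤ β)
    (H : a = 1 → g = 1 → h = 1 → k = 1 → u = 1 → β = 1) :
    a * (g * h) ≤ β + (1 - u) + g * (1 - k) := by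
  rcases ha with rfl | rfl <;> rcases hg with rfl | rfl <;> rcases hh with rfl | rfl <;>
    rcases hk with rfl | rfl <;> rcases hu with rfl | rfl <;> norm_num <;> try linarith
  have := H rfl rfl rfl rfl rfl
  linarith

lemma real_aux4 {a g h u β : ℝ} (ha : a = 0 ∨ a = 1) (hg : g = 0 ∨ g = 1) (hh : h = 0 ∨ h = 1)
    (hu : u = 0 ∨ u = 1) (hβ : 0 ≤ β)
    (H : a = 1 → g = 1 → h = 1 → u = 1 → β = 1) :
    a * (g * h) ≤ β + (1 - u) := by
  rcases ha with rfl | rfl <;> rcases hg with rfl | rfl <;> rcases hh with rfl | rfl <;>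
    rcases hu with rfl | rfl <;> norm_num <;> try linarith
  have := H rfl rfl rfl rfl
  linarith

lemma real_aux6 {a b h k u β : ℝ} (ha : a = 0 ∨ a = 1) (hb : b = 0 ∨ b = 1) (hh : h = 0 ∨ h = 1)
    (hk : k = 0 ∨ k = 1) (hu : u = 0 ∨ u = 1) (hβ : 0 ≤ β)
    (H : a = 1 → h = 1 → u = 1 → (b = 1 ∨ k = 1) → β = 1) :
    a * h ≤ β + (1 - u) + a * ((1 - b) * (1 - k)) := by
  rcases ha with rfl | rfl <;> rcases hb with rfl | rfl <;> rcases hh with rfl | rfl <;>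
    rcases hk with rfl | rfl <;> rcases hu with rfl | rfl <;> norm_num <;> try linarith
  all_goals
    have := H rfl rfl rfl (by norm_num)
    linarith

lemma stageB_num {α S E N s m t σ κ : ℝ} (hN : 0 < N) (hσ : 0 < σ) (hσ1 : σ ≤ 1 / 1000000)
    (hκ1 : κ ≤ 0.0007) (hκ0 : 0 ≤ κ) (hσN : 1 ≤ σ * N)
    (ht : t = (1 / 2 - σ) * N) (hsm : s + m = N)
    (hs1 : s ≤ (1 / 2 + σ) * N) (hs2 : (1 / 2 - σ) * N ≤ s)
    (hα : (0.2 : ℝ) * N ≤ α) (hα2 : α ≤ s)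
    (hS : S ≤ (1 / 8 + 13 * σ) * N ^ 2)
    (hE : E ≤ 10 * κ * N ^ 2 + 2 * σ * N ^ 2)
    (h : α * t - E + (s - α) * (t - s + α) - E - N ≤ S) : False := by
  obtain ⟨r, rfl⟩ : ∃ r, α = r * N := ⟨α / N, by field_simp⟩
  obtain ⟨q, rfl⟩ : ∃ q, s = q * N := ⟨s / N, by field_simp⟩
  have h1 : q ≤ 1 / 2 + σ := le_of_mul_le_mul_right hs1 hN
  have h2 : 1 / 2 - σ ≤ q := le_of_mul_le_mul_right hs2 hN
  have h3 : 0.2 ≤ r := le_of_mul_le_mul_right hα hN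
  have h4 : r ≤ q := le_of_mul_le_mul_right hα2 hN
  subst ht
  have hNN : N ≤ σ * N ^ 2 := by nlinarith
  have h5 : (r * (1 / 2 - σ) + (q - r) * ((1 / 2 - σ) - q + r)) * N ^ 2 ≤
      (1 / 8 + 13 * σ + 20 * κ + 4 * σ + σ) * N ^ 2 := by nlinarith
  have h6 : r * (1 / 2 - σ) + (q - r) * ((1 / 2 - σ) - q + r) ≤
      1 / 8 + 13 * σ + 20 * κ + 4 * σ + σ := le_of_mul_le_mul_right h5 (by positivity)
  have h7 : (q - r) * (r - 2 * σ) ≤ (q - r) * ((1 / 2 - σ) - q + r) :=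
    mul_le_mul_of_nonneg_left (by linarith) (by linarith)
  have h8 : (1 / 2 - σ - r) * (r - 2 * σ) ≤ (q - r) * (r - 2 * σ) :=
    mul_le_mul_of_nonneg_right (by linarith) (by linarith)
  have h9 : 0 ≤ (r - 0.2) * (0.500001 - r) := mul_nonneg (by linarith) (by linarith)
  nlinarith

lemma real_cov {a b : ℝ} (ha : a ≤ 1) (hb : b ≤ 1) : b ≤ 1 - a + a * b := by
  nlinarith [mul_nonneg (sub_nonneg.mpr ha) (sub_nonneg.mpr hb)]

set_option maxHeartbeats 2000000 in
lemma stageB (h3 : Is3Graph n H) (hXY : Disjoint X Y) (hU : X ∪ Y = Finset.univ)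
    {N σ κ : ℝ} (hN : N = n) (hσ : 0 < σ) (hσ1 : σ ≤ 1 / 1000000)
    (hκ1 : κ ≤ 0.0007) (hκ0 : 0 ≤ κ) (hσN : 1 ≤ σ * N) (hd : CodegLB H ((1 / 2 - σ) * N))
    (hX1 : (X.card : ℝ) ≤ (1 / 2 + σ) * N) (hX2 : (1 / 2 - σ) * N ≤ (X.card : ℝ))
    {x y w : Fin n} (hx : x ∈ X) (hy : y ∈ Y) (hw : w ∈ Y) (hg : hh H x y w = 1)
    (hdd : ∑ v ∈ Y, hh H x y v ≤ ∑ v ∈ Y, hh H x w v)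
    (hd1 : ∑ v ∈ Y, hh H x y v ≤ 0.29 * N)
    (hm : ∑ z ∈ X, (1 - hh H y w z) ≤ κ * N)
    (hM : ∑ v ∈ Y, ∑ z ∈ X, hh H x w v * (1 - hh H w v z) ≤ κ * N ^ 2)
    (hR1 : ∑ z ∈ X, ∑ t ∈ Y, bb H X Y x t y w z ≤ κ * N ^ 2)
    (hR2 : ∑ z ∈ X, ∑ t ∈ X, bb H X Y t w x y z ≤ κ * N ^ 2)
    (hS : ∑ y ∈ Y, ∑ z ∈ X, hh H x y z ≤ (1 / 8 + 13 * σ) * N ^ 2) : False := by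
  have hN0 : 0 < N := by
    by_contra h
    push Not at h
    nlinarith
  have hcard : (X.card : ℝ) + Y.card = N := by
    rw [hN, ← Nat.cast_add, ← Finset.card_union_of_disjoint hXY, hU]; simp
  have hXN : (X.card : ℝ) ≤ N := by have : (0 : ℝ) ≤ Y.card := by positivity
                                    linarith
  have hYN : (Y.card : ℝ) ≤ N := by have : (0 : ℝ) ≤ X.card := by positivity
                                    linarith
  have hne : ∀ {u v}, u ∈ X → v ∈ Y → u ≠ v := fun hu hv h =>
    (Finset.disjoint_left.mp hXY hu) (h ▸ hv)
  set t : ℝ := (1 / 2 - σ) * N with ht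
  set A : ℝ := ∑ z ∈ X, hh H x y z with hA
  have hA0 : 0 ≤ A := Finset.sum_nonneg fun z _ => hh_nonneg _ _ _
  have hAX : A ≤ X.card := by
    calc A ≤ ∑ z ∈ X, (1 : ℝ) := Finset.sum_le_sum fun z _ => hh_le _ _ _
      _ = _ := by simp
  have hAd : t ≤ A + ∑ v ∈ Y, hh H x y v := codeg_sum hXY hU hd (hne hx hy)
  -- key bridge facts
  have kz : ∀ z, hh H x y z = 1 → hh H y w z = 1 → kk H x y w z = 1 := by
    intro z e1 e2
    refine kk_perm (kk_of h3 (a := y) (b := x) (c := w) (d := z) ?_ ?_ e2) ?_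
    · rw [hh_swap12]; exact hg
    · rw [hh_swap12]; exact e1
    · ext; simp; tauto
  -- (iii)
  have S3 : ∑ z ∈ X, ∑ v ∈ Y, hh H x y z * (hh H x w v * hh H y z v) ≤ 3 * κ * N ^ 2 := by
    have h1 : ∑ z ∈ X, ∑ v ∈ Y, hh H x y z * (hh H x w v * hh H y z v) ≤
        ∑ z ∈ X, ∑ v ∈ Y, (bb H X Y x v y w z + (1 - hh H y w z)
          + hh H x w v * (1 - hh H w v z)) := by
      refine Finset.sum_le_sum fun z hz => Finset.sum_le_sum fun v hv => ?_
      refine real_aux3 (hh01 _ _ _) (hh01 _ _ _) (hh01 _ _ _) (hh01 _ _ _) (hh01 _ _ _)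
        (bb_nonneg _ _ _ _ _) ?_
      intro e1 e2 e4 e5 e6
      refine bb_of hx hv (kz z e1 e6) ?_
      refine kk_perm (kk_of h3 (a := z) (b := y) (c := w) (d := v) ?_ ?_ ?_) ?_
      · refine hh_perm e6 ?_; ext; simp; tauto
      · refine hh_perm e4 ?_; ext; simp; tauto
      · refine hh_perm e5 ?_; ext; simp; tauto
      · ext; simp; tauto
    have h2 : ∑ z ∈ X, ∑ v ∈ Y, (bb H X Y x v y w z + (1 - hh H y w z)
          + hh H x w v * (1 - hh H w v z)) = ∑ z ∈ X, ∑ v ∈ Y, bb H X Y x v y w z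
          + Y.card * ∑ z ∈ X, (1 - hh H y w z)
          + ∑ v ∈ Y, ∑ z ∈ X, hh H x w v * (1 - hh H w v z) := by
      rw [Finset.sum_comm (s := Y) (t := X)]
      simp only [Finset.sum_add_distrib, Finset.sum_const, nsmul_eq_mul, ← Finset.mul_sum]
    have h5 : Y.card * ∑ z ∈ X, (1 - hh H y w z) ≤ N * (κ * N) := by
      calc _ ≤ Y.card * (κ * N) := mul_le_mul_of_nonneg_left hm (by positivity)
        _ ≤ _ := mul_le_mul_of_nonneg_right hYN (by positivity)
    have h6 : N * (κ * N) = κ * N ^ 2 := by ring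
    linarith
  have hXm : ∑ z ∈ X, ∑ v ∈ X, (1 - hh H y w z) ≤ κ * N ^ 2 := by
    calc _ = X.card * ∑ z ∈ X, (1 - hh H y w z) := by
          simp only [Finset.sum_const, nsmul_eq_mul, ← Finset.mul_sum]
      _ ≤ X.card * (κ * N) := mul_le_mul_of_nonneg_left hm (by positivity)
      _ ≤ N * (κ * N) := mul_le_mul_of_nonneg_right hXN (by positivity)
      _ = _ := by ring
  have kw : ∀ z, hh H x y z = 1 → hh H y w z = 1 → kk H w x y z = 1 := by
    intro z e1 e2
    refine kk_perm (kz z e1 e2) ?_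
    ext; simp; tauto
  have S4 : ∑ z ∈ X, ∑ v ∈ X, hh H x y z * (hh H x y v * hh H y z v) ≤ 2 * κ * N ^ 2 := by
    have h1 : ∑ z ∈ X, ∑ v ∈ X, hh H x y z * (hh H x y v * hh H y z v) ≤
        ∑ z ∈ X, ∑ v ∈ X, (bb H X Y v w x y z + (1 - hh H y w z)) := by
      refine Finset.sum_le_sum fun z hz => Finset.sum_le_sum fun v hv => ?_
      refine real_aux4 (hh01 _ _ _) (hh01 _ _ _) (hh01 _ _ _) (hh01 _ _ _)
        (bb_nonneg _ _ _ _ _) ?_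
      intro e1 e2 e4 e5
      refine bb_of hv hw ?_ (kw z e1 e5)
      refine kk_perm (kk_of h3 (a := y) (b := x) (c := z) (d := v) ?_ ?_ ?_) ?_
      · refine hh_perm e1 ?_; ext; simp; tauto
      · refine hh_perm e2 ?_; ext; simp; tauto
      · refine hh_perm e4 ?_; ext; simp
      · ext; simp; tauto
    simp only [Finset.sum_add_distrib] at h1 hXm
    linarith
  have S5 : ∑ z ∈ X, ∑ v ∈ X, hh H x y z * ((1 - hh H x y v) * (1 - hh H y z v))
      ≤ 5 * κ * N ^ 2 + 2 * σ * N ^ 2 := by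
    have h1 : ∀ z ∈ X, ∑ v ∈ X, hh H x y z * ((1 - hh H x y v) * (1 - hh H y z v)) ≤
        hh H x y z * (2 * σ * N) + ∑ v ∈ Y, hh H x y z * (hh H x w v * hh H y z v)
        + ∑ v ∈ X, hh H x y z * (hh H x y v * hh H y z v) := by
      intro z hz
      rw [← Finset.mul_sum, ← Finset.mul_sum, ← Finset.mul_sum, ← mul_add, ← mul_add]
      refine mul_le_mul_of_nonneg_left ?_ (hh_nonneg _ _ _)
      have e1 : ∑ v ∈ X, (1 - hh H x y v) * (1 - hh H y z v) =
          X.card - A - ∑ v ∈ X, hh H y z v + ∑ v ∈ X, hh H x y v * hh H y z v := by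
        have : (X.card : ℝ) = ∑ v ∈ X, (1 : ℝ) := by simp
        rw [this, hA, ← Finset.sum_sub_distrib, ← Finset.sum_sub_distrib,
          ← Finset.sum_add_distrib]
        refine Finset.sum_congr rfl fun v _ => ?_
        ring
      have e2 : ∑ v ∈ Y, hh H y z v ≤ Y.card - ∑ v ∈ Y, hh H x w v
          + ∑ v ∈ Y, hh H x w v * hh H y z v := by
        have : (Y.card : ℝ) = ∑ v ∈ Y, (1 : ℝ) := by simp
        rw [this, ← Finset.sum_sub_distrib, ← Finset.sum_add_distrib]
        refine Finset.sum_le_sum fun v _ => ?_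
        exact real_cov (hh_le (H := H) x w v) (hh_le (H := H) y z v)
      have e3 := codeg_sum hXY hU hd (hne hz hy).symm
      rw [e1]
      linarith
    have h2 := Finset.sum_le_sum h1
    rw [Finset.sum_add_distrib, Finset.sum_add_distrib, ← Finset.sum_mul] at h2
    have h4 : A * (2 * σ * N) ≤ N * (2 * σ * N) :=
      mul_le_mul_of_nonneg_right (by linarith) (by positivity)
    have h6 : N * (2 * σ * N) = 2 * σ * N ^ 2 := by ring
    linarith
  set E : ℝ := ∑ z ∈ X, ∑ v ∈ X, hh H x y z * hh H x z v with hE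
  have S6 : E ≤ 10 * κ * N ^ 2 + 2 * σ * N ^ 2 := by
    have h1 : E ≤ ∑ z ∈ X, ∑ v ∈ X, (bb H X Y v w x y z + (1 - hh H y w z)
        + hh H x y z * ((1 - hh H x y v) * (1 - hh H y z v))) := by
      refine Finset.sum_le_sum fun z hz => Finset.sum_le_sum fun v hv => ?_
      refine real_aux6 (hh01 _ _ _) (hh01 _ _ _) (hh01 _ _ _) (hh01 _ _ _) (hh01 _ _ _)
        (bb_nonneg _ _ _ _ _) ?_
      intro e1 e2 e4 e5
      refine bb_of hv hw ?_ (kw z e1 e4)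
      rcases e5 with e5 | e5
      · refine kk_perm (kk_of h3 (a := x) (b := y) (c := z) (d := v) e1 e5 e2) ?_
        ext; simp; tauto
      · refine kk_perm (kk_of h3 (a := z) (b := x) (c := y) (d := v) ?_ ?_ ?_) ?_
        · refine hh_perm e1 ?_; ext; simp; tauto
        · refine hh_perm e2 ?_; ext; simp; tauto
        · refine hh_perm e5 ?_; ext; simp; tauto
        · ext; simp; tauto
    simp only [Finset.sum_add_distrib] at h1 hXm S5
    have h6 : 0 ≤ κ * N ^ 2 := by positivity
    linarith
  -- (vii)
  have hfin : A * t - E + (X.card - A) * (t - X.card + A) - E - N ≤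
      ∑ y ∈ Y, ∑ z ∈ X, hh H x y z := by
    have h1 : ∀ z ∈ X, hh H x y z * t - ∑ v ∈ X, hh H x y z * hh H x z v
        + (1 - hh H x y z) * (t - X.card + A) - ∑ v ∈ X, hh H x y v * hh H x z v
        - (if z = x then N else 0) ≤ ∑ v ∈ Y, hh H x v z := by
      intro z hz
      have e0 : ∑ v ∈ Y, hh H x v z = ∑ v ∈ Y, hh H x z v :=
        Finset.sum_congr rfl fun v _ => hh_swap23 _ _ _
      rw [e0]
      have p1 : 0 ≤ ∑ v ∈ X, hh H x y v * hh H x z v :=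
        Finset.sum_nonneg fun v _ => mul_nonneg (hh_nonneg _ _ _) (hh_nonneg _ _ _)
      have p2 : ∑ v ∈ X, hh H x z v ≤ X.card - A + ∑ v ∈ X, hh H x y v * hh H x z v := by
        have : (X.card : ℝ) = ∑ v ∈ X, (1 : ℝ) := by simp
        rw [this, hA, ← Finset.sum_sub_distrib, ← Finset.sum_add_distrib]
        refine Finset.sum_le_sum fun v _ => ?_
        exact real_cov (hh_le (H := H) x y v) (hh_le (H := H) x z v)
      rw [← Finset.mul_sum]
      have p4 : 0 ≤ ∑ v ∈ Y, hh H x z v := Finset.sum_nonneg fun v _ => hh_nonneg _ _ _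
      split_ifs with hzx
      · have hz0 : hh H x y z = 0 := by
          rcases hh01 (H := H) x y z with h | h
          · exact h
          · exact absurd hzx.symm (hh_ne h3 h).2.1
        rw [hz0]
        have h8 : 0 ≤ σ * N := by positivity
        have : t ≤ N := by rw [ht]; linarith
        linarith
      · have e3 := codeg_sum hXY hU hd (Ne.symm hzx)
        rcases hh01 (H := H) x y z with h | h <;> rw [h] <;> linarith
    have h2 := Finset.sum_le_sum h1
    rw [Finset.sum_sub_distrib, Finset.sum_sub_distrib, Finset.sum_add_distrib,
      Finset.sum_sub_distrib, ← Finset.sum_mul, ← Finset.sum_mul, Finset.sum_comm (s := X) (t := Y),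
      Finset.sum_ite_eq' X x (fun _ => N), if_pos hx, Finset.sum_sub_distrib] at h2
    have e5 : ∑ z ∈ X, ∑ v ∈ X, hh H x y v * hh H x z v = E := by
      rw [hE, Finset.sum_comm]
      refine Finset.sum_congr rfl fun v _ => Finset.sum_congr rfl fun z _ => ?_
      rw [hh_swap23 x z v]
    rw [e5] at h2
    simp only [Finset.sum_const, nsmul_eq_mul, mul_one] at h2
    linarith
  refine stageB_num hN0 hσ hσ1 hκ1 hκ0 hσN ht hcard hX1 hX2 ?_ hAX hS S6 hfin
  rw [ht] at hAd
  have h9 : σ * N ≤ 1 / 1000000 * N := mul_le_mul_of_nonneg_right hσ1 hN0.le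
  linarith

end core

section core2
variable {n : ℕ} {H : Finset (Finset (Fin n))} {X Y : Finset (Fin n)}

lemma real_auxM {g a b h : ℝ} (hg : g = 0 ∨ g = 1) (ha : a = 0 ∨ a = 1) (hb : b = 0 ∨ b = 1)
    (hh : h = 0 ∨ h = 1) :
    g * h ≤ g * a * h + g * b * h + g * (1 - a) * (1 - b) := by
  rcases hg with rfl | rfl <;> rcases ha with rfl | rfl <;> rcases hb with rfl | rfl <;>
    rcases hh with rfl | rfl <;> norm_num

lemma q_num {q e m N σ : ℝ} (hN : 0 < N) (hσ : 0 < σ) (hσ1 : σ ≤ 1 / 1000000)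
    (hm1 : m ≤ (1 / 2 + σ) * N) (hm2 : (1 / 2 - σ) * N ≤ m)
    (he1 : e ≤ (1 / 8 + 10 * σ) * N ^ 2) (he2 : (1 / 8 - 14 * σ) * N ^ 2 ≤ e)
    (h : m * q ≤ e * m ^ 2 - 2 * e ^ 2 + m * (3 * σ * N ^ 3)) : q ≤ 13 * σ * N ^ 3 := by
  by_contra hlt
  push Not at hlt
  obtain ⟨t, rfl⟩ : ∃ t, e = t * N ^ 2 := ⟨e / N ^ 2, by field_simp⟩
  obtain ⟨r, rfl⟩ : ∃ r, m = r * N := ⟨m / N, by field_simp⟩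
  have hr : r ≤ 1 / 2 + σ := le_of_mul_le_mul_right hm1 hN
  have hr2 : 1 / 2 - σ ≤ r := le_of_mul_le_mul_right hm2 hN
  have ht1 : t ≤ 1 / 8 + 10 * σ := le_of_mul_le_mul_right he1 (by positivity)
  have ht2 : 1 / 8 - 14 * σ ≤ t := le_of_mul_le_mul_right he2 (by positivity)
  have hm0 : 0 < r * N := mul_pos (by linarith) hN
  have h1 : r * N * (13 * σ * N ^ 3) < t * N ^ 2 * (r * N) ^ 2 - 2 * (t * N ^ 2) ^ 2
      + r * N * (3 * σ * N ^ 3) := lt_of_lt_of_le (mul_lt_mul_of_pos_left hlt hm0) h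
  have h' : N ^ 4 * (r * (13 * σ)) < N ^ 4 * (t * r ^ 2 - 2 * t ^ 2 + r * (3 * σ)) := by
    nlinarith
  have h2 : r * (13 * σ) < t * r ^ 2 - 2 * t ^ 2 + r * (3 * σ) :=
    lt_of_mul_lt_mul_left h' (by positivity)
  have hrr : r ^ 2 ≤ 1 / 4 + 1.1 * σ := by nlinarith
  have h4 : t * (r ^ 2 - 2 * t) ≤ t * (30 * σ) :=
    mul_le_mul_of_nonneg_left (by linarith) (by linarith)
  have h5 : t * (30 * σ) ≤ 0.13 * (30 * σ) := mul_le_mul_of_nonneg_right (by linarith) (by linarith)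
  have h6 : 0.4 * σ ≤ r * σ := mul_le_mul_of_nonneg_right (by linarith) (by linarith)
  nlinarith

set_option maxHeartbeats 2000000 in
lemma core (h3 : Is3Graph n H) (hXY : Disjoint X Y) (hU : X ∪ Y = Finset.univ)
    {N σ : ℝ} (hN : N = n) (hσ : 0 < σ) (hσ1 : σ ≤ 1 / 1000000)
    (hσN : 1 ≤ σ * N) (hd : CodegLB H ((1 / 2 - σ) * N))
    (hX1 : (X.card : ℝ) ≤ (1 / 2 + σ) * N) (hX2 : (1 / 2 - σ) * N ≤ (X.card : ℝ))
    {x x' : Fin n} (hx : x ∈ X) (hx' : x' ∈ X)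
    (ht : ∑ y ∈ Y, (1 - hh H x x' y) ≤ σ * N)
    (hD : ∑ y ∈ Y, ∑ z ∈ X, kk H x x' y z ≤ σ * N ^ 2)
    (hb : ∑ y ∈ Y, ∑ w ∈ Y, ∑ v ∈ Y, bb H X Y x' v x y w ≤ σ * N ^ 3)
    (hb' : ∑ y ∈ Y, ∑ w ∈ Y, ∑ v ∈ Y, bb H X Y x v x' y w ≤ σ * N ^ 3)
    (hR1 : ∑ y ∈ Y, ∑ w ∈ Y, ∑ z ∈ X, ∑ t ∈ Y, bb H X Y x t y w z ≤ σ * N ^ 4)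
    (hR2 : ∑ y ∈ Y, ∑ w ∈ Y, ∑ z ∈ X, ∑ t ∈ X, bb H X Y t w x y z ≤ σ * N ^ 4) : False := by
  have hN0 : 0 < N := by
    by_contra h
    push Not at h
    nlinarith
  have hcard : (X.card : ℝ) + Y.card = N := by
    rw [hN, ← Nat.cast_add, ← Finset.card_union_of_disjoint hXY, hU]; simp
  have hXN : (X.card : ℝ) ≤ N := by have : (0 : ℝ) ≤ Y.card := by positivity
                                    linarith
  have hYN : (Y.card : ℝ) ≤ N := by have : (0 : ℝ) ≤ X.card := by positivity
                                    linarith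
  have hY1 : (Y.card : ℝ) ≤ (1 / 2 + σ) * N := by linarith
  have hY2 : (1 / 2 - σ) * N ≤ (Y.card : ℝ) := by linarith
  have hY0 : (0 : ℝ) ≤ Y.card := by positivity
  have hne : ∀ {u v}, u ∈ X → v ∈ Y → u ≠ v := fun hu hv h =>
    (Finset.disjoint_left.mp hXY hu) (h ▸ hv)
  have ht' : ∑ y ∈ Y, (1 - hh H x' x y) ≤ σ * N := by
    calc _ = ∑ y ∈ Y, (1 - hh H x x' y) :=
          Finset.sum_congr rfl fun y _ => by rw [hh_swap12]
      _ ≤ _ := ht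
  have gs : ∀ u a b, hh H u a b = hh H u b a := fun u a b => hh_swap23 _ _ _
  -- link of x and x' in Y
  have key : ∀ u, (∑ y ∈ Y, ∑ w ∈ Y, ∑ v ∈ Y, hh H u y w * hh H u y v * hh H u w v
      ≤ 3 * σ * N ^ 3) → ∑ y ∈ Y, ∑ w ∈ Y, hh H u y w ≤ (1 / 8 + 10 * σ) * N ^ 2 := by
    intro u hu
    have h1 := tri_bound Y (hh H u) (gs u) _ hu
    refine e_upper hN0 hσ hσ1 hY0 hY1 (le_trans ?_ h1)
    refine mul_nonneg hY0 (Finset.sum_nonneg fun y _ => Finset.sum_nonneg fun w _ =>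
      Finset.sum_nonneg fun v _ => ?_)
    exact mul_nonneg (mul_nonneg (hh_nonneg _ _ _) (sub_nonneg.mpr (hh_le _ _ _)))
      (sub_nonneg.mpr (hh_le _ _ _))
  have htri := tri_few h3 hx' hYN hσ.le ht hb
  have htri' := tri_few h3 hx hYN hσ.le ht' hb'
  have hpath := path_few h3 hx' hYN hσ.le ht hb
  have he := key x htri
  have he' := key x' htri'
  set e : ℝ := ∑ y ∈ Y, ∑ w ∈ Y, hh H x y w with e_def
  set e' : ℝ := ∑ y ∈ Y, ∑ w ∈ Y, hh H x' y w with e'_def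
  have cs : ∀ u ∈ X, Y.card * ((1 / 2 - σ) * N) ≤ ∑ y ∈ Y, ∑ z ∈ X, hh H u y z
      + ∑ y ∈ Y, ∑ w ∈ Y, hh H u y w := by
    intro u hu
    rw [← Finset.sum_add_distrib]
    calc _ = ∑ y ∈ Y, ((1 / 2 - σ) * N) := by simp
      _ ≤ _ := Finset.sum_le_sum fun y hy => codeg_sum hXY hU hd (hne hu hy)
  have c1 := cs x hx
  have c2 := cs x' hx'
  rw [← e_def] at c1
  rw [← e'_def] at c2
  set SA : ℝ := ∑ y ∈ Y, ∑ z ∈ X, hh H x y z with SA_def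
  set SB : ℝ := ∑ y ∈ Y, ∑ z ∈ X, hh H x' y z with SB_def
  have hSS : SA + SB ≤ X.card * Y.card + 2 * σ * N ^ 2 := by
    have h1 : SA + SB ≤ ∑ y ∈ Y, ∑ z ∈ X, (1 + (1 - hh H x x' y) + kk H x x' y z) := by
      rw [SA_def, SB_def, ← Finset.sum_add_distrib]
      refine Finset.sum_le_sum fun y hy => ?_
      rw [← Finset.sum_add_distrib]
      refine Finset.sum_le_sum fun z hz => ?_
      have hk := kk_nonneg (H := H) x x' y z
      rcases hh01 (H := H) x y z with h1 | h1 <;> rcases hh01 (H := H) x' y z with h2 | h2 <;>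
        rcases hh01 (H := H) x x' y with h4 | h4 <;> rw [h1, h2, h4] <;> norm_num <;>
        try linarith
      have : kk H x x' y z = 1 := by
        refine kk_perm (kk_of h3 (a := y) (b := x) (c := x') (d := z) ?_ ?_ ?_) ?_
        · refine hh_perm h4 ?_; ext; simp; tauto
        · refine hh_perm h1 ?_; ext; simp; tauto
        · refine hh_perm h2 ?_; ext; simp; tauto
        · ext; simp; tauto
      linarith
    have h2 : ∑ y ∈ Y, ∑ z ∈ X, (1 + (1 - hh H x x' y) + kk H x x' y z) =
        X.card * Y.card + X.card * ∑ y ∈ Y, (1 - hh H x x' y)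
        + ∑ y ∈ Y, ∑ z ∈ X, kk H x x' y z := by
      simp only [Finset.sum_add_distrib, Finset.sum_const, nsmul_eq_mul, ← Finset.mul_sum]
      ring
    have h5 : X.card * ∑ y ∈ Y, (1 - hh H x x' y) ≤ N * (σ * N) := by
      calc _ ≤ X.card * (σ * N) := mul_le_mul_of_nonneg_left ht (by positivity)
        _ ≤ _ := mul_le_mul_of_nonneg_right hXN (by positivity)
    have h6 : N * (σ * N) = σ * N ^ 2 := by ring
    linarith
  have hXY4 : (X.card : ℝ) * Y.card ≤ 1 / 4 * N ^ 2 := by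
    rw [← hcard]; nlinarith [sq_nonneg ((X.card : ℝ) - Y.card)]
  have hYt : (1 / 4 - σ) * N ^ 2 ≤ Y.card * ((1 / 2 - σ) * N) := by
    have h1 : 0 ≤ (1 / 2 - σ) * N := mul_nonneg (by linarith) hN0.le
    have h2 := mul_le_mul_of_nonneg_right hY2 h1
    have h4 : (1 / 2 - σ) * N * ((1 / 2 - σ) * N) = (1 / 4 - σ) * N ^ 2 + σ ^ 2 * N ^ 2 := by ring
    have h5 : 0 ≤ σ ^ 2 * N ^ 2 := by positivity
    linarith
  have hSA : SA ≤ (1 / 8 + 13 * σ) * N ^ 2 := by linarith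
  have he2 : (1 / 8 - 14 * σ) * N ^ 2 ≤ e := by linarith
  -- sum of q
  have hq := q_num hN0 hσ hσ1 hY1 hY2 he he2 (tri_bound Y (hh H x) (gs x) _ htri)
  have hpath2 : ∑ y ∈ Y, ∑ w ∈ Y, ∑ v ∈ Y, hh H x y w * hh H x w v * hh H y w v ≤
      3 * σ * N ^ 3 := by
    rw [Finset.sum_comm]
    refine le_trans (le_of_eq ?_) hpath
    refine Finset.sum_congr rfl fun y _ => Finset.sum_congr rfl fun w _ =>
      Finset.sum_congr rfl fun v _ => ?_
    rw [gs x w y, hh_swap12 w y v]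
  have hD2 : ∑ y ∈ Y, ∑ w ∈ Y, ∑ v ∈ Y, hh H x y w * hh H y w v ≤ 19 * σ * N ^ 3 := by
    have h1 : ∑ y ∈ Y, ∑ w ∈ Y, ∑ v ∈ Y, hh H x y w * hh H y w v ≤
        ∑ y ∈ Y, ∑ w ∈ Y, ∑ v ∈ Y, (hh H x y w * hh H x y v * hh H y w v
          + hh H x y w * hh H x w v * hh H y w v
          + hh H x y w * (1 - hh H x y v) * (1 - hh H x w v)) :=
      Finset.sum_le_sum fun y _ => Finset.sum_le_sum fun w _ => Finset.sum_le_sum fun v _ =>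
        real_auxM (hh01 _ _ _) (hh01 _ _ _) (hh01 _ _ _) (hh01 _ _ _)
    simp only [Finset.sum_add_distrib] at h1
    linarith
  set M : Fin n → Fin n → ℝ := fun y w => ∑ z ∈ X, hh H x y w * (1 - hh H y w z) with M_def
  have M0 : ∀ y w, 0 ≤ M y w := fun y w => Finset.sum_nonneg fun z _ =>
    mul_nonneg (hh_nonneg _ _ _) (sub_nonneg.mpr (hh_le _ _ _))
  have Msymm : ∀ y w, M y w = M w y := fun y w => Finset.sum_congr rfl fun z _ => by
    rw [gs x y w, hh_swap12 y w z]
  have hM : ∑ y ∈ Y, ∑ w ∈ Y, M y w ≤ 20 * σ * N ^ 3 := by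
    have h1 : ∑ y ∈ Y, ∑ w ∈ Y, M y w ≤ ∑ y ∈ Y, ∑ w ∈ Y, (hh H x y w * (2 * σ * N)
        + ∑ v ∈ Y, hh H x y w * hh H y w v) := by
      refine Finset.sum_le_sum fun y _ => Finset.sum_le_sum fun w _ => ?_
      rw [M_def]
      simp only
      rw [← Finset.mul_sum, ← Finset.mul_sum, ← mul_add]
      rcases hh01 (H := H) x y w with h | h
      · rw [h]; simp
      · refine mul_le_mul_of_nonneg_left ?_ (hh_nonneg _ _ _)
        have := codeg_sum hXY hU hd (hh_ne h3 h).2.2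
        rw [Finset.sum_sub_distrib]
        simp only [Finset.sum_const, nsmul_eq_mul, mul_one]
        linarith
    simp only [Finset.sum_add_distrib, ← Finset.sum_mul] at h1
    rw [← e_def] at h1
    have h2 : e * (2 * σ * N) ≤ (1 / 2 * N ^ 2) * (2 * σ * N) := by
      refine mul_le_mul_of_nonneg_right ?_ (by positivity)
      have : σ * N ^ 2 ≤ 1 / 1000000 * N ^ 2 := mul_le_mul_of_nonneg_right hσ1 (by positivity)
      have : 0 ≤ N ^ 2 := by positivity
      linarith
    have h4 : (1 / 2 * N ^ 2) * (2 * σ * N) = σ * N ^ 3 := by ring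
    linarith
  set T : Fin n → Fin n → ℝ := fun y w => ∑ v ∈ Y, hh H x y w * hh H x y v * hh H x w v with T_def
  have T0 : ∀ y w, 0 ≤ T y w := fun y w => Finset.sum_nonneg fun z _ =>
    mul_nonneg (mul_nonneg (hh_nonneg _ _ _) (hh_nonneg _ _ _)) (hh_nonneg _ _ _)
  have Tsymm : ∀ y w, T y w = T w y := fun y w => Finset.sum_congr rfl fun z _ => by
    rw [gs x y w]; ring
  set P : Fin n → Fin n → ℝ := fun y w => ∑ z ∈ X, ∑ t ∈ Y, bb H X Y x t y w z with P_def
  have P0 : ∀ y w, 0 ≤ P y w := fun y w => Finset.sum_nonneg fun z _ =>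
    Finset.sum_nonneg fun t _ => bb_nonneg _ _ _ _ _
  set Q : Fin n → Fin n → ℝ := fun y w => ∑ z ∈ X, ∑ t ∈ X, bb H X Y t w x y z with Q_def
  have Q0 : ∀ y w, 0 ≤ Q y w := fun y w => Finset.sum_nonneg fun z _ =>
    Finset.sum_nonneg fun t _ => bb_nonneg _ _ _ _ _
  set L : Fin n → ℝ := fun y => ∑ w ∈ Y, M y w with L_def
  have L0 : ∀ y, 0 ≤ L y := fun y => Finset.sum_nonneg fun w _ => M0 y w
  set F : Fin n → Fin n → ℝ := fun y w => N * T y w + N * M y w + L y + L w + P y w + P w y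
    + Q y w + Q w y with F_def
  have Fsymm : ∀ y w, F y w = F w y := fun y w => by
    simp only [F_def]; rw [Tsymm y w, Msymm y w]; ring
  have F0 : ∀ y w, 0 ≤ F y w := fun y w => by
    have := mul_nonneg hN0.le (T0 y w)
    have := mul_nonneg hN0.le (M0 y w)
    simp only [F_def]
    linarith [L0 y, L0 w, P0 y w, P0 w y, Q0 y w, Q0 w y]
  have hFsum : ∑ y ∈ Y, ∑ w ∈ Y, F y w ≤ 67 * σ * N ^ 4 := by
    have h1 : ∑ y ∈ Y, ∑ w ∈ Y, F y w = N * ∑ y ∈ Y, ∑ w ∈ Y, T y w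
        + N * ∑ y ∈ Y, ∑ w ∈ Y, M y w + Y.card * ∑ y ∈ Y, L y + Y.card * ∑ y ∈ Y, L y
        + ∑ y ∈ Y, ∑ w ∈ Y, P y w + ∑ y ∈ Y, ∑ w ∈ Y, P y w
        + ∑ y ∈ Y, ∑ w ∈ Y, Q y w + ∑ y ∈ Y, ∑ w ∈ Y, Q y w := by
      simp only [F_def, Finset.sum_add_distrib, ← Finset.mul_sum, Finset.sum_const, nsmul_eq_mul]
      rw [Finset.sum_comm (f := fun y w => P w y), Finset.sum_comm (f := fun y w => Q w y)]
    have h2 : N * ∑ y ∈ Y, ∑ w ∈ Y, T y w ≤ N * (3 * σ * N ^ 3) :=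
      mul_le_mul_of_nonneg_left htri hN0.le
    have h4 : N * ∑ y ∈ Y, ∑ w ∈ Y, M y w ≤ N * (20 * σ * N ^ 3) :=
      mul_le_mul_of_nonneg_left hM hN0.le
    have h5 : Y.card * ∑ y ∈ Y, L y ≤ N * (20 * σ * N ^ 3) :=
      mul_le_mul hYN hM (Finset.sum_nonneg fun y _ => L0 y) hN0.le
    have h6 : N * (20 * σ * N ^ 3) = 20 * σ * N ^ 4 := by ring
    have h7 : N * (3 * σ * N ^ 3) = 3 * σ * N ^ 4 := by ring
    rw [h1]
    linarith
  -- choose the edge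
  obtain ⟨y0, hy0, w0, hw0, hg0, hF0⟩ : ∃ y ∈ Y, ∃ w ∈ Y, hh H x y w = 1 ∧
      F y w ≤ 670 * σ * N ^ 2 := by
    by_contra hcon
    push Not at hcon
    have h1 : e * (670 * σ * N ^ 2) ≤ ∑ y ∈ Y, ∑ w ∈ Y, F y w := by
      rw [e_def, Finset.sum_mul]
      refine Finset.sum_le_sum fun y hy => ?_
      rw [Finset.sum_mul]
      refine Finset.sum_le_sum fun w hw => ?_
      rcases hh01 (H := H) x y w with h | h
      · rw [h, zero_mul]; exact F0 y w
      · rw [h, one_mul]; exact (hcon y hy w hw h).le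
    have h2 : (1 / 9 * N ^ 2) * (670 * σ * N ^ 2) ≤ e * (670 * σ * N ^ 2) := by
      refine mul_le_mul_of_nonneg_right ?_ (by positivity)
      have : σ * N ^ 2 ≤ 1 / 1000000 * N ^ 2 := mul_le_mul_of_nonneg_right hσ1 (by positivity)
      have : 0 ≤ N ^ 2 := by positivity
      linarith
    have h4 : (1 / 9 * N ^ 2) * (670 * σ * N ^ 2) = 670 / 9 * (σ * N ^ 4) := by ring
    have h5 : 0 < σ * N ^ 4 := by positivity
    linarith
  obtain ⟨y, hy, w, hw, hg, hF, hdd⟩ : ∃ y ∈ Y, ∃ w ∈ Y, hh H x y w = 1 ∧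
      F y w ≤ 670 * σ * N ^ 2 ∧ ∑ v ∈ Y, hh H x y v ≤ ∑ v ∈ Y, hh H x w v := by
    rcases le_total (∑ v ∈ Y, hh H x y0 v) (∑ v ∈ Y, hh H x w0 v) with h | h
    · exact ⟨y0, hy0, w0, hw0, hg0, hF0, h⟩
    · exact ⟨w0, hw0, y0, hy0, by rw [gs]; exact hg0, by rw [Fsymm]; exact hF0, h⟩
  have b1 := mul_nonneg hN0.le (T0 y w)
  have b2 := mul_nonneg hN0.le (M0 y w)
  have b3 := L0 y
  have b4 := L0 w
  have b5 := P0 y w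
  have b6 := P0 w y
  have b7 := Q0 y w
  have b8 := Q0 w y
  have hF' : N * T y w + N * M y w + L y + L w + P y w + P w y + Q y w + Q w y
      ≤ 670 * σ * N ^ 2 := hF
  have d1 : N * T y w ≤ N * (670 * σ * N) := by
    have : N * (670 * σ * N) = 670 * σ * N ^ 2 := by ring
    linarith
  have d2 : N * M y w ≤ N * (670 * σ * N) := by
    have : N * (670 * σ * N) = 670 * σ * N ^ 2 := by ring
    linarith
  have d1' := le_of_mul_le_mul_left d1 hN0
  have d2' := le_of_mul_le_mul_left d2 hN0
  have hsm : σ * N ≤ 1 / 1000000 * N := mul_le_mul_of_nonneg_right hσ1 hN0.le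
  refine stageB h3 hXY hU hN hσ hσ1 (κ := 670 * σ) (by linarith) (by positivity) hσN hd hX1 hX2
    hx hy hw hg hdd ?_ ?_ ?_ ?_ ?_ hSA
  · -- degree bound
    have h1 : ∑ v ∈ Y, hh H x y v + ∑ v ∈ Y, hh H x w v ≤ Y.card + T y w := by
      have e1 : (Y.card : ℝ) = ∑ v ∈ Y, (1 : ℝ) := by simp
      simp only [T_def]
      rw [e1, ← Finset.sum_add_distrib, ← Finset.sum_add_distrib]
      refine Finset.sum_le_sum fun v _ => ?_
      rw [hg]
      rcases hh01 (H := H) x y v with h | h <;> rcases hh01 (H := H) x w v with h' | h' <;>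
        rw [h, h'] <;> norm_num
    linarith
  · refine le_trans (le_of_eq ?_) d2'
    simp only [M_def]
    rw [hg]; simp
  · have : L w ≤ 670 * σ * N ^ 2 := by linarith
    exact this
  · have : P y w ≤ 670 * σ * N ^ 2 := by linarith
    exact this
  · have : Q y w ≤ 670 * σ * N ^ 2 := by linarith
    exact this

end core2

/-! ### Counting bridges of length `c + 1` -/

section count
variable {n : ℕ} {H : Finset (Finset (Fin n))} {X Y : Finset (Fin n)}

lemma card_through (k : ℕ) (v : Fin n) (𝒯 : Finset (Finset (Fin n)))
    (h : ∀ T ∈ 𝒯, T.card = k ∧ v ∈ T) : 𝒯.card ≤ n ^ (k - 1) := by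
  have h1 : 𝒯.card ≤ ((Finset.univ : Finset (Fin n)).powersetCard (k - 1)).card := by
    refine Finset.card_le_card_of_injOn (fun T => T.erase v) ?_ ?_
    · intro T hT
      have := h T hT
      rw [Finset.mem_coe, Finset.mem_powersetCard]
      exact ⟨Finset.subset_univ _, by rw [Finset.card_erase_of_mem this.2, this.1]⟩
    · intro T hT T' hT' e
      have h1 := (h T hT).2
      have h2 := (h T' hT').2
      simp only at e
      rw [← Finset.insert_erase h1, ← Finset.insert_erase h2, e]
  rw [Finset.card_powersetCard] at h1
  simp only [Finset.card_univ, Fintype.card_fin] at h1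
  exact h1.trans (Nat.choose_le_pow _ _)

lemma card_meeting (k : ℕ) (W : Finset (Fin n)) (hW : W.card ≤ 6) (𝒯 : Finset (Finset (Fin n)))
    (h : ∀ T ∈ 𝒯, T.card = k ∧ ¬ Disjoint T W) : 𝒯.card ≤ 6 * n ^ (k - 1) := by
  have hsub : 𝒯 ⊆ W.biUnion fun v => 𝒯.filter fun T => v ∈ T := by
    intro T hT
    obtain ⟨v, hv1, hv2⟩ := Finset.not_disjoint_iff.mp (h T hT).2
    rw [Finset.mem_biUnion]
    exact ⟨v, hv2, Finset.mem_filter.mpr ⟨hT, hv1⟩⟩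
  calc 𝒯.card ≤ _ := Finset.card_le_card hsub
    _ ≤ W.card * n ^ (k - 1) := by
        refine Finset.card_biUnion_le_card_mul _ _ _ fun v _ => card_through k v _ ?_
        intro T hT
        rw [Finset.mem_filter] at hT
        exact ⟨(h T hT.1).1, hT.2⟩
    _ ≤ _ := Nat.mul_le_mul_right _ hW

/-- underlying set of a quadruple -/
def qset {n : ℕ} (s : Fin n × Fin n × Fin n × Fin n) : Finset (Fin n) :=
  {s.1, s.2.1, s.2.2.1, s.2.2.2}

lemma bridge_count {c : ℕ} (hc : 0 < c) {η : ℝ} (hn : 12 ≤ η * n)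
    (Q : Finset (Fin n × Fin n × (Fin n × Fin n × Fin n × Fin n)))
    (hQ : ∀ q ∈ Q, ∃ 𝒯 : Finset (Finset (Fin n)), η * (n : ℝ) ^ (4 * c - 1) ≤ 𝒯.card ∧
      ∀ T ∈ 𝒯, T.card = 4 * c - 1 ∧
        (Disjoint T (insert q.1 (insert q.2.1 (qset q.2.2))) →
          q.1 ∈ X ∧ q.2.1 ∈ Y ∧ IsConnector H (c + 1) q.1 q.2.1 (qset q.2.2 ∪ T))) :
    Q.card * (η / 2 * (n : ℝ) ^ (4 * c - 1)) ≤ (4 * c + 3 : ℝ) ^ 4 * BridgeCount H (c + 1) X Y := by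
  classical
  choose! 𝒯 h𝒯1 h𝒯2 using hQ
  set 𝒰 : (Fin n × Fin n × (Fin n × Fin n × Fin n × Fin n)) → Finset (Finset (Fin n)) :=
    fun q => (𝒯 q).filter fun T => Disjoint T (insert q.1 (insert q.2.1 (qset q.2.2))) with h𝒰
  have hU : ∀ q ∈ Q, η / 2 * (n : ℝ) ^ (4 * c - 1) ≤ (𝒰 q).card := by
    intro q hq
    have h1 := Finset.card_filter_add_card_filter_not (s := 𝒯 q)
      (fun T => Disjoint T (insert q.1 (insert q.2.1 (qset q.2.2))))
    have h2 : ((𝒯 q).filter fun T => ¬ Disjoint T (insert q.1 (insert q.2.1 (qset q.2.2)))).card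
        ≤ 6 * n ^ (4 * c - 1 - 1) := by
      refine card_meeting (4 * c - 1) (insert q.1 (insert q.2.1 (qset q.2.2))) ?_ _ ?_
      · refine (Finset.card_insert_le _ _).trans ?_
        have := Finset.card_insert_le q.2.1 (qset q.2.2)
        have h4 : (qset q.2.2).card ≤ 4 := Finset.card_le_four
        omega
      · intro T hT
        rw [Finset.mem_filter] at hT
        exact ⟨(h𝒯2 q hq T hT.1).1, hT.2⟩
    have h3 := h𝒯1 q hq
    rw [← h1] at h3
    push_cast at h3
    have h4 : (((𝒯 q).filter fun T =>
        ¬ Disjoint T (insert q.1 (insert q.2.1 (qset q.2.2)))).card : ℝ)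
        ≤ 6 * (n : ℝ) ^ (4 * c - 1 - 1) := by exact_mod_cast h2
    have h5 : 6 * (n : ℝ) ^ (4 * c - 1 - 1) ≤ η / 2 * (n : ℝ) ^ (4 * c - 1) := by
      have e : 4 * c - 1 = (4 * c - 1 - 1) + 1 := by omega
      conv_rhs => rw [e, pow_succ]
      have : (0 : ℝ) ≤ (n : ℝ) ^ (4 * c - 1 - 1) := by positivity
      nlinarith
    change _ ≤ (((𝒯 q).filter fun T =>
      Disjoint T (insert q.1 (insert q.2.1 (qset q.2.2)))).card : ℝ)
    linarith
  set B : Set (Fin n × Fin n × Finset (Fin n)) := {t : Fin n × Fin n × Finset (Fin n) |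
    t.1 ∈ X ∧ t.2.1 ∈ Y ∧ IsConnector H (c + 1) t.1 t.2.1 t.2.2} with hB
  have hBf : B.Finite := Set.toFinite _
  have hBc : BridgeCount H (c + 1) X Y = hBf.toFinset.card := by
    unfold BridgeCount
    rw [← Set.ncard_eq_toFinset_card B hBf]
  have hmain : (Q.sigma 𝒰).card ≤ (4 * c + 3) ^ 4 * hBf.toFinset.card := by
    refine Finset.card_le_mul_card_image_of_maps_to
      (f := fun p => (p.1.1, p.1.2.1, qset p.1.2.2 ∪ p.2)) ?_ _ ?_
    · rintro ⟨q, T⟩ hp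
      rw [Finset.mem_sigma] at hp
      obtain ⟨hq, hT⟩ := hp
      simp only [h𝒰, Finset.mem_filter] at hT
      rw [Set.Finite.mem_toFinset]
      exact (h𝒯2 q hq T hT.1).2 hT.2
    · rintro ⟨a, b, S⟩ hS
      rw [Set.Finite.mem_toFinset] at hS
      have hSc : S.card = 4 * c + 3 := by
        have := hS.2.2.2.2.1
        simp only at this
        omega
      have : (S ×ˢ S ×ˢ S ×ˢ S).card = (4 * c + 3) ^ 4 := by
        simp only [Finset.card_product, hSc]; ring
      rw [← this]
      refine Finset.card_le_card_of_injOn (fun p => p.1.2.2) ?_ ?_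
      · rintro ⟨⟨a', b', s⟩, T⟩ hp
        simp only [Finset.coe_filter, Set.mem_ofPred_eq, Prod.mk.injEq] at hp
        obtain ⟨-, -, -, rfl⟩ := hp
        simp [qset]
      · rintro ⟨⟨a', b', s⟩, T⟩ hp ⟨⟨a'', b'', s'⟩, T'⟩ hp' e
        simp only [Finset.coe_filter, Set.mem_ofPred_eq, Prod.mk.injEq, Finset.mem_sigma,
          h𝒰, Finset.mem_filter] at hp hp' e
        obtain ⟨⟨-, -, hd⟩, rfl, rfl, h1⟩ := hp
        obtain ⟨⟨-, -, hd'⟩, rfl, rfl, h2⟩ := hp'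
        subst e
        have hds : Disjoint T (qset s) := hd.mono_right
          ((Finset.subset_insert _ _).trans (Finset.subset_insert _ _))
        have hds' : Disjoint T' (qset s) := hd'.mono_right
          ((Finset.subset_insert _ _).trans (Finset.subset_insert _ _))
        have e1 : T = S \ qset s := by
          rw [← h1, Finset.union_sdiff_left, Finset.sdiff_eq_self_of_disjoint hds]
        have e2 : T' = S \ qset s := by
          rw [← h2, Finset.union_sdiff_left, Finset.sdiff_eq_self_of_disjoint hds']
        rw [e1, e2]
  rw [hBc]
  have h7 : (Q.card : ℝ) * (η / 2 * (n : ℝ) ^ (4 * c - 1)) ≤ ((Q.sigma 𝒰).card : ℝ) := by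
    rw [Finset.card_sigma]
    push_cast
    calc _ = ∑ q ∈ Q, (η / 2 * (n : ℝ) ^ (4 * c - 1)) := by simp
      _ ≤ _ := Finset.sum_le_sum hU
  have h8 : ((Q.sigma 𝒰).card : ℝ) ≤ (4 * c + 3 : ℝ) ^ 4 * hBf.toFinset.card := by
    exact_mod_cast hmain
  linarith

/-! Building connectors -/

lemma factor_union {A B : Finset (Fin n)} (hA : HasK4mFactorOn H A) (hB : HasK4mFactorOn H B)
    (hd : Disjoint A B) : HasK4mFactorOn H (A ∪ B) := by
  classical
  obtain ⟨P, p1, p2, p3⟩ := hA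
  obtain ⟨Q, q1, q2, q3⟩ := hB
  have hPA : ∀ S ∈ P, S ⊆ A := fun S hS => by
    rw [← p3]; exact Finset.subset_biUnion_of_mem id hS
  have hQB : ∀ S ∈ Q, S ⊆ B := fun S hS => by
    rw [← q3]; exact Finset.subset_biUnion_of_mem id hS
  refine ⟨P ∪ Q, ?_, ?_, ?_⟩
  · intro S hS
    rcases Finset.mem_union.mp hS with h | h
    · exact p1 S h
    · exact q1 S h
  · intro S hS T hT hne
    rcases Finset.mem_union.mp hS with h | h <;> rcases Finset.mem_union.mp hT with h' | h'
    · exact p2 S h T h' hne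
    · exact hd.mono (hPA S h) (hQB T h')
    · exact (hd.mono (hPA T h') (hQB S h)).symm
    · exact q2 S h T h' hne
  · rw [Finset.union_biUnion, p3, q3]

lemma factor_single {S : Finset (Fin n)} (h : SpansK4m H S) : HasK4mFactorOn H S := by
  classical
  refine ⟨{S}, by simpa using h, ?_, by simp⟩
  intro A hA B hB hne
  simp at hA hB
  exact absurd (hA.trans hB.symm) hne

end count

section build
variable {n : ℕ} {H : Finset (Finset (Fin n))} {X Y : Finset (Fin n)}

lemma half_factor {a α : Fin n} {A S T : Finset (Fin n)} (hS : S = insert α A)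
    (h1 : SpansK4m H (insert a A)) (h2 : HasK4mFactorOn H (insert α T)) (hα : α ∉ A)
    (haα : a ≠ α) (hT : Disjoint T (insert a S)) : HasK4mFactorOn H (insert a (S ∪ T)) := by
  have e : insert a (S ∪ T) = insert a A ∪ insert α T := by
    rw [hS]; ext t; simp only [Finset.mem_insert, Finset.mem_union]; tauto
  rw [e]
  refine factor_union (factor_single h1) h2 ?_
  rw [Finset.disjoint_insert_right]
  refine ⟨?_, ?_⟩
  · rw [Finset.mem_insert]
    rintro (h | h)
    · exact haα h.symm
    · exact hα h
  · refine hT.symm.mono_left ?_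
    rw [hS]
    exact Finset.insert_subset_insert _ (Finset.subset_insert _ _)

lemma conn_of {c : ℕ} (hc : 0 < c) {a b α β : Fin n} {A B S T : Finset (Fin n)}
    (hSA : S = insert α A) (hSB : S = insert β B) (hA : α ∉ A) (hB : β ∉ B)
    (ha : a ∉ A) (hb : b ∉ B) (haα : a ≠ α) (hbβ : b ≠ β)
    (h1 : SpansK4m H (insert a A)) (h2 : SpansK4m H (insert b B))
    (h3 : HasK4mFactorOn H (insert α T)) (h4 : HasK4mFactorOn H (insert β T))
    (hTc : T.card = 4 * c - 1) (hT : Disjoint T (insert a (insert b S))) :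
    IsConnector H (c + 1) a b (S ∪ T) := by
  have hTa : Disjoint T (insert a S) := hT.mono_right
    (Finset.insert_subset_insert _ (Finset.subset_insert _ _))
  have hTb : Disjoint T (insert b S) := hT.mono_right (Finset.subset_insert _ _)
  rw [Finset.disjoint_insert_right] at hT
  have hT2 := hT.2
  rw [Finset.disjoint_insert_right] at hT2
  refine ⟨?_, ?_, ?_, half_factor hSA h1 h3 hA haα hTa, half_factor hSB h2 h4 hB hbβ hTb⟩
  · rw [Finset.mem_union, hSA, Finset.mem_insert]
    have := hT.1
    tauto
  · rw [Finset.mem_union, hSB, Finset.mem_insert]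
    have := hT2.1
    tauto
  · rw [Finset.card_union_of_disjoint hT2.2.symm, hTc]
    have h5 := h1.1
    rw [Finset.card_insert_of_notMem ha] at h5
    rw [hSA, Finset.card_insert_of_notMem hA]
    omega

lemma spans_ne {a b c d : Fin n} (h : SpansK4m H {a, b, c, d}) :
    a ≠ b ∧ a ≠ c ∧ a ≠ d ∧ b ≠ c ∧ b ≠ d ∧ c ≠ d := by
  have h4 := h.1
  have key : ∀ p q r : Fin n, ({p, q, r} : Finset (Fin n)).card ≤ 3 :=
    fun p q r => Finset.card_le_three
  refine ⟨?_, ?_, ?_, ?_, ?_, ?_⟩ <;> intro e <;> subst e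
  · have := key a c d; simp only [Finset.insert_idem] at h4; omega
  · have := key a b d
    have e : ({a, b, a, d} : Finset (Fin n)) = {a, b, d} := by ext; simp; tauto
    rw [e] at h4; omega
  · have := key a b c
    have e : ({a, b, c, a} : Finset (Fin n)) = {a, b, c} := by ext; simp; tauto
    rw [e] at h4; omega
  · have := key a b d
    have e : ({a, b, b, d} : Finset (Fin n)) = {a, b, d} := by ext; simp
    rw [e] at h4; omega
  · have := key a b c
    have e : ({a, b, c, b} : Finset (Fin n)) = {a, b, c} := by ext; simp; tauto
    rw [e] at h4; omega
  · have := key a b c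
    have e : ({a, b, c, c} : Finset (Fin n)) = {a, b, c} := by ext; simp
    rw [e] at h4; omega

open Classical in
/-- six-tuples giving bridges, second kind -/
noncomputable def Qsix {n : ℕ} (H : Finset (Finset (Fin n))) (X Y W : Finset (Fin n)) :
    Finset (Fin n × Fin n × (Fin n × Fin n × Fin n × Fin n)) :=
  Finset.univ.filter fun q => q.1 ∈ X ∧ q.2.1 ∈ Y ∧ q.2.2.2.2.1 ∈ W ∧ q.2.2.2.2.2 ∈ W ∧
    q.2.2.2.2.2 ≠ q.2.2.2.2.1 ∧ q.2.2.2.2.2 ≠ q.2.1 ∧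
    SpansK4m H {q.2.2.1, q.2.2.2.1, q.2.2.2.2.1, q.2.1} ∧
    SpansK4m H {q.2.2.1, q.2.2.2.1, q.2.2.2.2.2, q.1}

lemma qsix_bound (hXY : Disjoint X Y) {c : ℕ} (hc : 0 < c) {η : ℝ} (hn : 12 ≤ η * n)
    {W : Finset (Fin n)} (hW : W ⊆ Y) (hcl : ClosedOn H c η W) :
    (Qsix H X Y W).card * (η / 2 * (n : ℝ) ^ (4 * c - 1))
      ≤ (4 * c + 3 : ℝ) ^ 4 * BridgeCount H (c + 1) X Y := by
  classical
  refine bridge_count hc hn _ ?_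
  rintro ⟨z, b, x, x', y, y1⟩ hq
  simp only [Qsix, Finset.mem_filter, Finset.mem_univ, true_and] at hq
  obtain ⟨hz, hb, hy, hy1, hne, hne2, hk, hk1⟩ := hq
  have hfin : {S : Finset (Fin n) | IsConnector H c y y1 S}.Finite := Set.toFinite _
  refine ⟨hfin.toFinset, ?_, ?_⟩
  · have := hcl y hy y1 hy1 hne.symm
    unfold Close at this
    rwa [Set.ncard_eq_toFinset_card _ hfin] at this
  · intro T hT
    rw [Set.Finite.mem_toFinset] at hT
    obtain ⟨t1, t2, t3, t4, t5⟩ := hT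
    refine ⟨t3, fun hd => ⟨hz, hb, ?_⟩⟩
    obtain ⟨n1, n2, n3, n4, n5, n6⟩ := spans_ne hk
    obtain ⟨m1, m2, m3, m4, m5, m6⟩ := spans_ne hk1
    have hzy : z ≠ y := fun e => Finset.disjoint_left.mp hXY hz (e ▸ hW hy)
    have e1 : ({x, x', y1, z} : Finset (Fin n)) = insert z {x, x', y1} := by ext; simp; tauto
    have e2 : ({x, x', y, b} : Finset (Fin n)) = insert b {x, x', y} := by ext; simp; tauto
    rw [e1] at hk1
    rw [e2] at hk
    refine conn_of hc (α := y) (β := y1) (A := {x, x', y1}) (B := {x, x', y}) ?_ ?_ ?_ ?_ ?_ ?_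
      hzy hne2.symm hk1 hk t4 t5 t3 hd
    · unfold qset; ext; simp; tauto
    · unfold qset; ext; simp; tauto
    · simp; exact ⟨n2.symm, n4.symm, hne.symm⟩
    · simp; exact ⟨m2.symm, m4.symm, hne⟩
    · simp; exact ⟨m3.symm, m5.symm, m6.symm⟩
    · simp; exact ⟨n3.symm, n5.symm, n6.symm⟩

/-- total number of ordered bridges of length one -/
noncomputable def Qfive {n : ℕ} (H : Finset (Finset (Fin n))) (X Y : Finset (Fin n)) : ℝ :=
  ∑ a, ∑ b, ∑ u, ∑ v, ∑ p, bb H X Y a b u v p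

lemma qfive_bound {c : ℕ} (hc : 0 < c) {η : ℝ} (hη : 0 < η) (hn : 12 ≤ η * n)
    {W : Finset (Fin n)} (hcl : ClosedOn H c η W)
    (hWc : (n : ℝ) / 10 + 5 ≤ W.card) :
    Qfive H X Y * (n / 10) * (η / 2 * (n : ℝ) ^ (4 * c - 1))
      ≤ (4 * c + 3 : ℝ) ^ 4 * BridgeCount H (c + 1) X Y := by
  classical
  set Q : Finset (Fin n × Fin n × (Fin n × Fin n × Fin n × Fin n)) :=
    Finset.univ.filter fun q => (q.1 ∈ X ∧ q.2.1 ∈ Y ∧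
      SpansK4m H {q.1, q.2.2.1, q.2.2.2.1, q.2.2.2.2.1} ∧
      SpansK4m H {q.2.1, q.2.2.1, q.2.2.2.1, q.2.2.2.2.1}) ∧
      q.2.2.2.2.2 ∈ W \ {q.1, q.2.1, q.2.2.1, q.2.2.2.1, q.2.2.2.2.1} with hQ
  have hcard : Qfive H X Y * (n / 10) ≤ Q.card := by
    rw [hQ, Finset.card_filter]
    push_cast
    simp only [Fintype.sum_prod_type]
    unfold Qfive
    simp only [Finset.sum_mul]
    refine Finset.sum_le_sum fun a _ => Finset.sum_le_sum fun b _ => Finset.sum_le_sum fun u _ =>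
      Finset.sum_le_sum fun v _ => Finset.sum_le_sum fun p _ => ?_
    unfold bb
    by_cases h : a ∈ X ∧ b ∈ Y ∧ SpansK4m H {a, u, v, p} ∧ SpansK4m H {b, u, v, p}
    · rw [if_pos h]
      have h5 : ({a, b, u, v, p} : Finset (Fin n)).card ≤ 5 := Finset.card_le_five
      have h6 := Finset.le_card_sdiff ({a, b, u, v, p} : Finset (Fin n)) W
      have h7 : W.card ≤ (W \ {a, b, u, v, p}).card + 5 := by omega
      have h8 : (W.card : ℝ) ≤ (W \ {a, b, u, v, p}).card + 5 := by exact_mod_cast h7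
      simp only [h, true_and]
      rw [Finset.sum_boole, Finset.filter_univ_mem]
      linarith
    · rw [if_neg h]
      simp only [zero_mul]
      refine Finset.sum_nonneg fun _ _ => ?_
      split_ifs <;> norm_num
  have hb := bridge_count (H := H) (X := X) (Y := Y) hc hn Q ?_
  · refine le_trans ?_ hb
    have : 0 ≤ η / 2 * (n : ℝ) ^ (4 * c - 1) := by positivity
    exact mul_le_mul_of_nonneg_right hcard this
  rintro ⟨a, b, u, v, p, r⟩ hq
  simp only [hQ, Finset.mem_filter, Finset.mem_univ, true_and, Finset.mem_sdiff] at hq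
  obtain ⟨⟨ha, hb, hk1, hk2⟩, hr, hrn⟩ := hq
  simp only [Finset.mem_insert, Finset.mem_singleton, not_or] at hrn
  obtain ⟨r1, r2, r3, r4, r5⟩ := hrn
  obtain ⟨s, hs, hsr⟩ : ∃ s ∈ W, s ≠ r := by
    refine Finset.exists_mem_ne ?_ r
    have : (1 : ℝ) < W.card := by
      have : (0 : ℝ) ≤ n := by positivity
      linarith
    exact_mod_cast this
  have hfin : {S : Finset (Fin n) | IsConnector H c r s S}.Finite := Set.toFinite _
  refine ⟨hfin.toFinset, ?_, ?_⟩
  · have := hcl r hr s hs hsr.symm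
    unfold Close at this
    rwa [Set.ncard_eq_toFinset_card _ hfin] at this
  · intro T hT
    rw [Set.Finite.mem_toFinset] at hT
    obtain ⟨t1, t2, t3, t4, t5⟩ := hT
    refine ⟨t3, fun hd => ⟨ha, hb, ?_⟩⟩
    obtain ⟨n1, n2, n3, n4, n5, n6⟩ := spans_ne hk1
    obtain ⟨m1, m2, m3, -, -, -⟩ := spans_ne hk2
    refine conn_of hc (α := r) (β := r) (A := {u, v, p}) (B := {u, v, p}) ?_ ?_ ?_ ?_ ?_ ?_
      (Ne.symm r1) (Ne.symm r2) hk1 hk2 t4 t4 t3 hd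
    · unfold qset; ext; simp; tauto
    · unfold qset; ext; simp; tauto
    · simp; tauto
    · simp; tauto
    · simp; tauto
    · simp; tauto

end build

section average
variable {n : ℕ} {H : Finset (Finset (Fin n))} {X Y : Finset (Fin n)}

lemma su {ι : Type*} [Fintype ι] {s : Finset ι} {f g : ι → ℝ} (hg : ∀ a, 0 ≤ g a)
    (h : ∀ a ∈ s, f a ≤ g a) : ∑ a ∈ s, f a ≤ ∑ a, g a :=
  (Finset.sum_le_sum h).trans
    (Finset.sum_le_sum_of_subset_of_nonneg (Finset.subset_univ _) fun a _ _ => hg a)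

lemma kk_le (a b c d : Fin n) : kk H a b c d ≤ 1 := by
  unfold kk; split_ifs <;> norm_num

/-- the five-fold sums are dominated by `Qfive` -/
lemma five_a : ∑ x, ∑ x', ∑ y ∈ Y, ∑ w ∈ Y, ∑ v ∈ Y, bb H X Y x' v x y w ≤ Qfive H X Y := by
  have h1 : ∑ x, ∑ x', ∑ y ∈ Y, ∑ w ∈ Y, ∑ v ∈ Y, bb H X Y x' v x y w
      ≤ ∑ x, ∑ x', ∑ y, ∑ w, ∑ v, bb H X Y x' v x y w := by
    refine Finset.sum_le_sum fun x _ => Finset.sum_le_sum fun x' _ => ?_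
    refine su (fun y => ?_) fun y _ => su (fun w => ?_) fun w _ => su (fun v => ?_) fun v _ => le_rfl
    all_goals repeat' first | exact bb_nonneg _ _ _ _ _ | refine Finset.sum_nonneg fun _ _ => ?_
  refine h1.trans (le_of_eq ?_)
  have := Fintype.sum_equiv
    (⟨fun q => (q.2.1, q.2.2.2.2, q.1, q.2.2.1, q.2.2.2.1),
      fun q => (q.2.2.1, q.1, q.2.2.2.1, q.2.2.2.2, q.2.1), fun _ => rfl, fun _ => rfl⟩ :
      (Fin n × Fin n × Fin n × Fin n × Fin n) ≃ (Fin n × Fin n × Fin n × Fin n × Fin n))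
    (fun q => bb H X Y q.2.1 q.2.2.2.2 q.1 q.2.2.1 q.2.2.2.1)
    (fun q => bb H X Y q.1 q.2.1 q.2.2.1 q.2.2.2.1 q.2.2.2.2) (fun _ => rfl)
  simpa only [Fintype.sum_prod_type, Qfive] using this

lemma five_b : ∑ x, ∑ x', ∑ y ∈ Y, ∑ w ∈ Y, ∑ v ∈ Y, bb H X Y x v x' y w ≤ Qfive H X Y := by
  rw [Finset.sum_comm]
  exact five_a

lemma five_c : ∑ x, ∑ _x' : Fin n, ∑ y ∈ Y, ∑ w ∈ Y, ∑ z ∈ X, ∑ t ∈ Y, bb H X Y x t y w z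
    ≤ n * Qfive H X Y := by
  have h0 : ∑ x, ∑ y ∈ Y, ∑ w ∈ Y, ∑ z ∈ X, ∑ t ∈ Y, bb H X Y x t y w z ≤ Qfive H X Y := by
    have h1 : ∑ x, ∑ y ∈ Y, ∑ w ∈ Y, ∑ z ∈ X, ∑ t ∈ Y, bb H X Y x t y w z
        ≤ ∑ x, ∑ y, ∑ w, ∑ z, ∑ t, bb H X Y x t y w z := by
      refine Finset.sum_le_sum fun x _ => ?_
      refine su (fun y => ?_) fun y _ => su (fun w => ?_) fun w _ => su (fun v => ?_)
        fun v _ => su (fun v => ?_) fun v _ => le_rfl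
      all_goals repeat' first | exact bb_nonneg _ _ _ _ _ | refine Finset.sum_nonneg fun _ _ => ?_
    refine h1.trans (le_of_eq ?_)
    have := Fintype.sum_equiv
      (⟨fun q => (q.1, q.2.2.2.2, q.2.1, q.2.2.1, q.2.2.2.1),
        fun q => (q.1, q.2.2.1, q.2.2.2.1, q.2.2.2.2, q.2.1), fun _ => rfl, fun _ => rfl⟩ :
        (Fin n × Fin n × Fin n × Fin n × Fin n) ≃ (Fin n × Fin n × Fin n × Fin n × Fin n))
      (fun q => bb H X Y q.1 q.2.2.2.2 q.2.1 q.2.2.1 q.2.2.2.1)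
      (fun q => bb H X Y q.1 q.2.1 q.2.2.1 q.2.2.2.1 q.2.2.2.2) (fun _ => rfl)
    simpa only [Fintype.sum_prod_type, Qfive] using this
  simp only [Finset.sum_const, Finset.card_univ, Fintype.card_fin, nsmul_eq_mul]
  rw [← Finset.mul_sum]
  exact mul_le_mul_of_nonneg_left h0 (by positivity)

lemma five_d : ∑ x, ∑ _x' : Fin n, ∑ y ∈ Y, ∑ w ∈ Y, ∑ z ∈ X, ∑ t ∈ X, bb H X Y t w x y z
    ≤ n * Qfive H X Y := by
  have h0 : ∑ x, ∑ y ∈ Y, ∑ w ∈ Y, ∑ z ∈ X, ∑ t ∈ X, bb H X Y t w x y z ≤ Qfive H X Y := by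
    have h1 : ∑ x, ∑ y ∈ Y, ∑ w ∈ Y, ∑ z ∈ X, ∑ t ∈ X, bb H X Y t w x y z
        ≤ ∑ x, ∑ y, ∑ w, ∑ z, ∑ t, bb H X Y t w x y z := by
      refine Finset.sum_le_sum fun x _ => ?_
      refine su (fun y => ?_) fun y _ => su (fun w => ?_) fun w _ => su (fun v => ?_)
        fun v _ => su (fun v => ?_) fun v _ => le_rfl
      all_goals repeat' first | exact bb_nonneg _ _ _ _ _ | refine Finset.sum_nonneg fun _ _ => ?_
    refine h1.trans (le_of_eq ?_)
    have := Fintype.sum_equiv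
      (⟨fun q => (q.2.2.2.2, q.2.2.1, q.1, q.2.1, q.2.2.2.1),
        fun q => (q.2.2.1, q.2.2.2.1, q.2.1, q.2.2.2.2, q.1), fun _ => rfl, fun _ => rfl⟩ :
        (Fin n × Fin n × Fin n × Fin n × Fin n) ≃ (Fin n × Fin n × Fin n × Fin n × Fin n))
      (fun q => bb H X Y q.2.2.2.2 q.2.2.1 q.1 q.2.1 q.2.2.2.1)
      (fun q => bb H X Y q.1 q.2.1 q.2.2.1 q.2.2.2.1 q.2.2.2.2) (fun _ => rfl)
    simpa only [Fintype.sum_prod_type, Qfive] using this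
  simp only [Finset.sum_const, Finset.card_univ, Fintype.card_fin, nsmul_eq_mul]
  rw [← Finset.mul_sum]
  exact mul_le_mul_of_nonneg_left h0 (by positivity)

open Classical in
/-- the six-fold sum is dominated by `Qsix` up to degenerate tuples -/
lemma six_a {W W' : Finset (Fin n)} (hW' : W' ⊆ Y) :
    ∑ x, ∑ x', (∑ y ∈ W, ∑ y' ∈ W', kk H x x' y y') * (∑ y1 ∈ W, ∑ z ∈ X, kk H x x' y1 z)
      ≤ (Qsix H X Y W).card + 2 * (n : ℝ) ^ 5 := by
  have h1 : ∑ x, ∑ x', (∑ y ∈ W, ∑ y' ∈ W', kk H x x' y y') * (∑ y1 ∈ W, ∑ z ∈ X, kk H x x' y1 z)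
      ≤ ∑ x, ∑ x', ∑ y, ∑ y', ∑ y1, ∑ z,
        ((if (z, y', x, x', y, y1) ∈ Qsix H X Y W then (1 : ℝ) else 0)
          + (if y1 = y then 1 else 0) + (if y1 = y' then 1 else 0)) := by
    refine Finset.sum_le_sum fun x _ => Finset.sum_le_sum fun x' _ => ?_
    rw [Finset.sum_mul]
    have nn : ∀ y y' y1 z : Fin n,
        0 ≤ ((if (z, y', x, x', y, y1) ∈ Qsix H X Y W then (1 : ℝ) else 0)
          + (if y1 = y then 1 else 0) + (if y1 = y' then 1 else 0)) := by
      intro y y' y1 z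
      split_ifs <;> norm_num
    refine su (fun y => ?_) fun y hy => ?_
    · repeat' first | exact nn _ _ _ _ | refine Finset.sum_nonneg fun _ _ => ?_
    rw [Finset.sum_mul]
    refine su (fun y => ?_) fun y' hy' => ?_
    · repeat' first | exact nn _ _ _ _ | refine Finset.sum_nonneg fun _ _ => ?_
    rw [Finset.mul_sum]
    refine su (fun y => ?_) fun y1 hy1 => ?_
    · repeat' first | exact nn _ _ _ _ | refine Finset.sum_nonneg fun _ _ => ?_
    rw [Finset.mul_sum]
    refine su (fun y => nn _ _ _ _) fun z hz => ?_
    by_cases e1 : y1 = y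
    · rw [if_pos e1]
      have a1 := kk_le (H := H) x x' y y'
      have a2 := kk_le (H := H) x x' y1 z
      have a3 := kk_nonneg (H := H) x x' y1 z
      have : kk H x x' y y' * kk H x x' y1 z ≤ 1 := mul_le_one₀ a1 a3 a2
      split_ifs <;> linarith
    by_cases e2 : y1 = y'
    · rw [if_pos e2]
      have a1 := kk_le (H := H) x x' y y'
      have a2 := kk_le (H := H) x x' y1 z
      have a3 := kk_nonneg (H := H) x x' y1 z
      have : kk H x x' y y' * kk H x x' y1 z ≤ 1 := mul_le_one₀ a1 a3 a2
      split_ifs <;> linarith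
    rw [if_neg e1, if_neg e2]
    by_cases hk : SpansK4m H {x, x', y, y'} ∧ SpansK4m H {x, x', y1, z}
    · rw [if_pos]
      · simp [kk, hk.1, hk.2]
      · simp only [Qsix, Finset.mem_filter, Finset.mem_univ, true_and]
        exact ⟨hz, hW' hy', hy, hy1, e1, e2, hk.1, hk.2⟩
    · have : kk H x x' y y' * kk H x x' y1 z = 0 := by
        unfold kk
        split_ifs <;> simp_all
      rw [this]
      split_ifs <;> norm_num
  refine h1.trans ?_
  simp only [Finset.sum_add_distrib]
  have h2 : ∑ x, ∑ x', ∑ y, ∑ y', ∑ y1, ∑ z,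
      (if (z, y', x, x', y, y1) ∈ Qsix H X Y W then (1 : ℝ) else 0) = (Qsix H X Y W).card := by
    have := Fintype.sum_equiv
      (⟨fun q => (q.2.2.2.2.2, q.2.2.2.1, q.1, q.2.1, q.2.2.1, q.2.2.2.2.1),
        fun q => (q.2.2.1, q.2.2.2.1, q.2.2.2.2.1, q.2.1, q.2.2.2.2.2, q.1),
        fun _ => rfl, fun _ => rfl⟩ :
        (Fin n × Fin n × Fin n × Fin n × Fin n × Fin n) ≃
          (Fin n × Fin n × Fin n × Fin n × Fin n × Fin n))
      (fun q => if (q.2.2.2.2.2, q.2.2.2.1, q.1, q.2.1, q.2.2.1, q.2.2.2.2.1) ∈ Qsix H X Y W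
        then (1 : ℝ) else 0)
      (fun q => if q ∈ Qsix H X Y W then (1 : ℝ) else 0) (fun _ => rfl)
    have hs : (∑ q : Fin n × Fin n × Fin n × Fin n × Fin n × Fin n,
        if q ∈ Qsix H X Y W then (1 : ℝ) else 0) = (Qsix H X Y W).card := by
      simp
    rw [← hs, ← this]
    simp only [Fintype.sum_prod_type]
  have h3 : ∑ x : Fin n, ∑ x' : Fin n, ∑ y : Fin n, ∑ y' : Fin n, ∑ y1 : Fin n, ∑ z : Fin n,
      (if y1 = y then (1 : ℝ) else 0) = (n : ℝ) ^ 5 := by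
    simp only [Finset.sum_const, Finset.card_univ, Fintype.card_fin, nsmul_eq_mul,
      ← Finset.mul_sum, Finset.sum_ite_eq', Finset.mem_univ, if_true]
    ring
  have h4 : ∑ x : Fin n, ∑ x' : Fin n, ∑ y : Fin n, ∑ y' : Fin n, ∑ y1 : Fin n, ∑ z : Fin n,
      (if y1 = y' then (1 : ℝ) else 0) = (n : ℝ) ^ 5 := by
    simp only [Finset.sum_const, Finset.card_univ, Fintype.card_fin, nsmul_eq_mul,
      ← Finset.mul_sum, Finset.sum_ite_eq', Finset.mem_univ, if_true]
    ring
  rw [h2, h3, h4]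
  linarith

/-- number of pairs completing `x,x'` -/
noncomputable def mm {n : ℕ} (H : Finset (Finset (Fin n))) (V₃ V₄ : Finset (Fin n))
    (x x' : Fin n) : ℝ := ∑ y ∈ V₃, ∑ y' ∈ V₄, kk H x x' y y'

lemma mm_nonneg (V₃ V₄ : Finset (Fin n)) (x x' : Fin n) : 0 ≤ mm H V₃ V₄ x x' :=
  Finset.sum_nonneg fun _ _ => Finset.sum_nonneg fun _ _ => kk_nonneg _ _ _ _

lemma mm_le (V₃ V₄ : Finset (Fin n)) (x x' : Fin n) : mm H V₃ V₄ x x' ≤ (n : ℝ) ^ 2 := by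
  unfold mm
  calc _ ≤ ∑ _y : Fin n, ∑ _y' : Fin n, (1 : ℝ) := by
        refine su (fun _ => by positivity) fun y _ => su (fun _ => by norm_num) fun y' _ => kk_le _ _ _ _
    _ = _ := by simp; ring

lemma six_sum {V₃ V₄ : Finset (Fin n)} (hY : Y = V₃ ∪ V₄) :
    ∑ x, ∑ x', mm H V₃ V₄ x x' * (∑ y1 ∈ Y, ∑ z ∈ X, kk H x x' y1 z)
      ≤ (Qsix H X Y V₃).card + (Qsix H X Y V₄).card + 4 * (n : ℝ) ^ 5 := by
  have hV3 : V₃ ⊆ Y := hY ▸ Finset.subset_union_left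
  have hV4 : V₄ ⊆ Y := hY ▸ Finset.subset_union_right
  have h1 := six_a (H := H) (X := X) (Y := Y) (W := V₃) (W' := V₄) hV4
  have h2 := six_a (H := H) (X := X) (Y := Y) (W := V₄) (W' := V₃) hV3
  have h3 : ∑ x, ∑ x', mm H V₃ V₄ x x' * (∑ y1 ∈ Y, ∑ z ∈ X, kk H x x' y1 z)
      ≤ ∑ x, ∑ x', ((∑ y ∈ V₃, ∑ y' ∈ V₄, kk H x x' y y') * (∑ y1 ∈ V₃, ∑ z ∈ X, kk H x x' y1 z)
       + (∑ y ∈ V₄, ∑ y' ∈ V₃, kk H x x' y y') * (∑ y1 ∈ V₄, ∑ z ∈ X, kk H x x' y1 z)) := by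
    refine Finset.sum_le_sum fun x _ => Finset.sum_le_sum fun x' _ => ?_
    have e : ∑ y ∈ V₄, ∑ y' ∈ V₃, kk H x x' y y' = mm H V₃ V₄ x x' := by
      unfold mm
      rw [Finset.sum_comm]
      refine Finset.sum_congr rfl fun y _ => Finset.sum_congr rfl fun y' _ => ?_
      unfold kk
      have : ({x, x', y', y} : Finset (Fin n)) = {x, x', y, y'} := by ext; simp; tauto
      rw [this]
    rw [e]
    change _ ≤ mm H V₃ V₄ x x' * _ + _
    rw [← mul_add]
    refine mul_le_mul_of_nonneg_left ?_ (mm_nonneg _ _ _ _)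
    have := Finset.sum_union_inter (s₁ := V₃) (s₂ := V₄) (f := fun y1 => ∑ z ∈ X, kk H x x' y1 z)
    have h0 : 0 ≤ ∑ y1 ∈ V₃ ∩ V₄, ∑ z ∈ X, kk H x x' y1 z :=
      Finset.sum_nonneg fun _ _ => Finset.sum_nonneg fun _ _ => kk_nonneg _ _ _ _
    rw [hY]
    linarith
  simp only [Finset.sum_add_distrib] at h3
  linarith

open Classical in
/-- pairs satisfying (T1) -/
noncomputable def PP {n : ℕ} (H : Finset (Finset (Fin n))) (ρ : ℝ) (X Y : Finset (Fin n)) :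
    Finset (Fin n × Fin n) :=
  (X ×ˢ X).filter fun p => (Y.card : ℝ) - ρ * n ≤ (degOn H p.1 p.2 Y : ℝ)

lemma typ_count (ρ : ℝ) (V₃ V₄ : Finset (Fin n)) :
    (({S : Finset (Fin n) | ∃ x ∈ X, ∃ x' ∈ X, ∃ y ∈ V₃, ∃ y' ∈ V₄,
      S = {x, x', y, y'} ∧ SpansK4m H S ∧ TypicalTriple H ρ X Y x x' y}.ncard : ℕ) : ℝ)
      ≤ ∑ p ∈ PP H ρ X Y, mm H V₃ V₄ p.1 p.2 := by
  classical
  set A : Finset ((Fin n × Fin n) × Fin n × Fin n) :=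
    (PP H ρ X Y ×ˢ V₃ ×ˢ V₄).filter fun q => SpansK4m H {q.1.1, q.1.2, q.2.1, q.2.2} with hA
  have h1 : {S : Finset (Fin n) | ∃ x ∈ X, ∃ x' ∈ X, ∃ y ∈ V₃, ∃ y' ∈ V₄,
      S = {x, x', y, y'} ∧ SpansK4m H S ∧ TypicalTriple H ρ X Y x x' y} ⊆
      ((A.image fun q => ({q.1.1, q.1.2, q.2.1, q.2.2} : Finset (Fin n)) :
        Finset (Finset (Fin n))) : Set (Finset (Fin n))) := by
    rintro S ⟨x, hx, x', hx', y, hy, y', hy', rfl, hk, ht⟩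
    rw [Finset.mem_coe, Finset.mem_image]
    refine ⟨((x, x'), y, y'), ?_, rfl⟩
    simp only [hA, PP, Finset.mem_filter, Finset.mem_product]
    exact ⟨⟨⟨⟨hx, hx'⟩, ht.1⟩, hy, hy'⟩, hk⟩
  have h2 := Set.ncard_le_ncard h1 (Finset.finite_toSet _)
  rw [Set.ncard_coe_finset] at h2
  have h3 := h2.trans Finset.card_image_le
  have h4 : (A.card : ℝ) = ∑ p ∈ PP H ρ X Y, mm H V₃ V₄ p.1 p.2 := by
    rw [hA, Finset.card_filter]
    push_cast
    rw [Finset.sum_product]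
    refine Finset.sum_congr rfl fun p _ => ?_
    rw [Finset.sum_product]
    unfold mm kk
    refine Finset.sum_congr rfl fun y _ => Finset.sum_congr rfl fun y' _ => ?_
    split_ifs <;> rfl
  rw [← h4]
  exact_mod_cast h3

lemma t1_sum {ρ : ℝ} {x x' : Fin n} (h : (Y.card : ℝ) - ρ * n ≤ (degOn H x x' Y : ℝ)) :
    ∑ y ∈ Y, (1 - hh H x x' y) ≤ ρ * n := by
  have : (degOn H x x' Y : ℝ) = ∑ y ∈ Y, hh H x x' y := by
    unfold degOn hh
    rw [Finset.card_filter]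
    push_cast
    refine Finset.sum_congr rfl fun y _ => ?_
    split_ifs <;> rfl
  rw [Finset.sum_sub_distrib, ← this]
  simp
  linarith

/-- weighted averaging, abstract form -/
lemma select_aux {n : ℕ} (P : Finset (Fin n × Fin n)) (m D R1 R2 R3 R4 : Fin n → Fin n → ℝ)
    {N σ δ ε : ℝ} (hN0 : 0 < N) (hε : 0 < ε) (hσ : 0 < σ)
    (hδ : 50 * δ ≤ σ * ε) (hδ0 : 0 < δ) (hδN : 1 ≤ δ * N)
    (hm : ε * N ^ 4 ≤ ∑ p ∈ P, m p.1 p.2)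
    (hm0 : ∀ x x', 0 ≤ m x x') (hmle : ∀ x x', m x x' ≤ N ^ 2)
    (D0 : ∀ x x', 0 ≤ D x x') (R10 : ∀ x x', 0 ≤ R1 x x') (R20 : ∀ x x', 0 ≤ R2 x x')
    (R30 : ∀ x x', 0 ≤ R3 x x') (R40 : ∀ x x', 0 ≤ R4 x x')
    (s0 : ∑ x, ∑ x', m x x' * D x x' ≤ 2 * δ * N ^ 6 + 4 * N ^ 5)
    (s1 : ∑ x, ∑ x', R1 x x' ≤ 10 * δ * N ^ 5) (s2 : ∑ x, ∑ x', R2 x x' ≤ 10 * δ * N ^ 5)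
    (s3 : ∑ x, ∑ x', R3 x x' ≤ N * (10 * δ * N ^ 5))
    (s4 : ∑ x, ∑ x', R4 x x' ≤ N * (10 * δ * N ^ 5)) :
    ∃ p ∈ P, D p.1 p.2 ≤ σ * N ^ 2 ∧ R1 p.1 p.2 ≤ σ * N ^ 3 ∧ R2 p.1 p.2 ≤ σ * N ^ 3 ∧
      R3 p.1 p.2 ≤ σ * N ^ 4 ∧ R4 p.1 p.2 ≤ σ * N ^ 4 := by
  set F : Fin n → Fin n → ℝ := fun x x' =>
    D x x' * N ^ 2 + (R1 x x' + R2 x x') * N + R3 x x' + R4 x x' with hF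
  have htot : ∑ p ∈ P, m p.1 p.2 * F p.1 p.2 ≤ 46 * δ * N ^ 8 := by
    have t1 : ∑ p ∈ P, m p.1 p.2 * F p.1 p.2 ≤
        ∑ p : Fin n × Fin n, (N ^ 2 * (m p.1 p.2 * D p.1 p.2) + N ^ 3 * R1 p.1 p.2
          + N ^ 3 * R2 p.1 p.2 + N ^ 2 * R3 p.1 p.2 + N ^ 2 * R4 p.1 p.2) := by
      refine su ?_ ?_
      · rintro ⟨x, x'⟩
        have := D0 x x'
        have := R10 x x'
        have := R20 x x'
        have := R30 x x'
        have := R40 x x'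
        have := hm0 x x'
        positivity
      · rintro ⟨x, x'⟩ -
        have e1 := mul_le_mul_of_nonneg_right (hmle x x') (R10 x x')
        have e2 := mul_le_mul_of_nonneg_right (hmle x x') (R20 x x')
        have e3 := mul_le_mul_of_nonneg_right (hmle x x') (R30 x x')
        have e4 := mul_le_mul_of_nonneg_right (hmle x x') (R40 x x')
        have e1' := mul_le_mul_of_nonneg_right e1 hN0.le
        have e2' := mul_le_mul_of_nonneg_right e2 hN0.le
        simp only [hF]
        linarith
    rw [Fintype.sum_prod_type] at t1
    simp only [Finset.sum_add_distrib, ← Finset.mul_sum] at t1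
    have q0 := mul_le_mul_of_nonneg_left s0 (show 0 ≤ N ^ 2 by positivity)
    have q1 := mul_le_mul_of_nonneg_left s1 (show 0 ≤ N ^ 3 by positivity)
    have q2 := mul_le_mul_of_nonneg_left s2 (show 0 ≤ N ^ 3 by positivity)
    have q3 := mul_le_mul_of_nonneg_left s3 (show 0 ≤ N ^ 2 by positivity)
    have q4 := mul_le_mul_of_nonneg_left s4 (show 0 ≤ N ^ 2 by positivity)
    have q5 := mul_le_mul_of_nonneg_right hδN (show 0 ≤ 4 * N ^ 7 by positivity)
    linarith
  obtain ⟨p, hp, hlt⟩ : ∃ p ∈ P,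
      m p.1 p.2 * F p.1 p.2 < m p.1 p.2 * (σ * N ^ 4) := by
    refine Finset.exists_lt_of_sum_lt ?_
    rw [← Finset.sum_mul]
    have q1 := mul_le_mul_of_nonneg_right hm (show 0 ≤ σ * N ^ 4 by positivity)
    have q2 := mul_le_mul_of_nonneg_right hδ (show 0 ≤ N ^ 8 by positivity)
    have q3 : 0 < δ * N ^ 8 := by positivity
    linarith
  have hF1 : F p.1 p.2 < σ * N ^ 4 := lt_of_mul_lt_mul_left hlt (hm0 _ _)
  simp only [hF] at hF1
  have d0 := D0 p.1 p.2
  have d1 := R10 p.1 p.2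
  have d2 := R20 p.1 p.2
  have d3 := R30 p.1 p.2
  have d4 := R40 p.1 p.2
  have f0 : 0 ≤ D p.1 p.2 * N ^ 2 := by positivity
  have f1 : 0 ≤ R1 p.1 p.2 * N := by positivity
  have f2 : 0 ≤ R2 p.1 p.2 * N := by positivity
  refine ⟨p, hp, ?_, ?_, ?_, ?_, ?_⟩
  · refine le_of_mul_le_mul_right (?_ : D p.1 p.2 * N ^ 2 ≤ _) (show 0 < N ^ 2 by positivity)
    linarith
  · refine le_of_mul_le_mul_right (?_ : R1 p.1 p.2 * N ≤ _) hN0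
    linarith
  · refine le_of_mul_le_mul_right (?_ : R2 p.1 p.2 * N ≤ _) hN0
    linarith
  · linarith
  · linarith

/-- weighted averaging -/
lemma select {V₃ V₄ : Finset (Fin n)} (hY : Y = V₃ ∪ V₄) {N σ δ ε ρ : ℝ} (hN : N = n)
    (hN0 : 0 < N) (hε : 0 < ε) (hσ : 0 < σ)
    (hδ : 50 * δ ≤ σ * ε) (hδ0 : 0 < δ) (hδN : 1 ≤ δ * N)
    (hm : ε * N ^ 4 ≤ ∑ p ∈ PP H ρ X Y, mm H V₃ V₄ p.1 p.2)
    (h5 : Qfive H X Y ≤ 10 * δ * N ^ 5)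
    (h63 : ((Qsix H X Y V₃).card : ℝ) ≤ δ * N ^ 6)
    (h64 : ((Qsix H X Y V₄).card : ℝ) ≤ δ * N ^ 6) :
    ∃ p ∈ PP H ρ X Y,
      ∑ y ∈ Y, ∑ z ∈ X, kk H p.1 p.2 y z ≤ σ * N ^ 2 ∧
      ∑ y ∈ Y, ∑ w ∈ Y, ∑ v ∈ Y, bb H X Y p.2 v p.1 y w ≤ σ * N ^ 3 ∧
      ∑ y ∈ Y, ∑ w ∈ Y, ∑ v ∈ Y, bb H X Y p.1 v p.2 y w ≤ σ * N ^ 3 ∧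
      ∑ y ∈ Y, ∑ w ∈ Y, ∑ z ∈ X, ∑ t ∈ Y, bb H X Y p.1 t y w z ≤ σ * N ^ 4 ∧
      ∑ y ∈ Y, ∑ w ∈ Y, ∑ z ∈ X, ∑ t ∈ X, bb H X Y t w p.1 y z ≤ σ * N ^ 4 := by
  set D : Fin n → Fin n → ℝ := fun x x' => ∑ y ∈ Y, ∑ z ∈ X, kk H x x' y z with hD
  set R1 : Fin n → Fin n → ℝ := fun x x' => ∑ y ∈ Y, ∑ w ∈ Y, ∑ v ∈ Y, bb H X Y x' v x y w with hR1
  set R2 : Fin n → Fin n → ℝ := fun x x' => ∑ y ∈ Y, ∑ w ∈ Y, ∑ v ∈ Y, bb H X Y x v x' y w with hR2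
  set R3 : Fin n → Fin n → ℝ := fun x _ => ∑ y ∈ Y, ∑ w ∈ Y, ∑ z ∈ X, ∑ t ∈ Y, bb H X Y x t y w z
    with hR3
  set R4 : Fin n → Fin n → ℝ := fun x _ => ∑ y ∈ Y, ∑ w ∈ Y, ∑ z ∈ X, ∑ t ∈ X, bb H X Y t w x y z
    with hR4
  have D0 : ∀ x x', 0 ≤ D x x' := fun x x' =>
    Finset.sum_nonneg fun _ _ => Finset.sum_nonneg fun _ _ => kk_nonneg _ _ _ _
  have R10 : ∀ x x', 0 ≤ R1 x x' := fun x x' => Finset.sum_nonneg fun _ _ =>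
    Finset.sum_nonneg fun _ _ => Finset.sum_nonneg fun _ _ => bb_nonneg _ _ _ _ _
  have R20 : ∀ x x', 0 ≤ R2 x x' := fun x x' => Finset.sum_nonneg fun _ _ =>
    Finset.sum_nonneg fun _ _ => Finset.sum_nonneg fun _ _ => bb_nonneg _ _ _ _ _
  have R30 : ∀ x x', 0 ≤ R3 x x' := fun x x' => Finset.sum_nonneg fun _ _ => Finset.sum_nonneg
    fun _ _ => Finset.sum_nonneg fun _ _ => Finset.sum_nonneg fun _ _ => bb_nonneg _ _ _ _ _
  have R40 : ∀ x x', 0 ≤ R4 x x' := fun x x' => Finset.sum_nonneg fun _ _ => Finset.sum_nonneg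
    fun _ _ => Finset.sum_nonneg fun _ _ => Finset.sum_nonneg fun _ _ => bb_nonneg _ _ _ _ _
  have s0 : ∑ x, ∑ x', mm H V₃ V₄ x x' * D x x' ≤ 2 * δ * N ^ 6 + 4 * N ^ 5 := by
    have := six_sum (H := H) (X := X) hY
    rw [← hN] at this
    linarith
  have s1 : ∑ x, ∑ x', R1 x x' ≤ 10 * δ * N ^ 5 := five_a.trans h5
  have s2 : ∑ x, ∑ x', R2 x x' ≤ 10 * δ * N ^ 5 := five_b.trans h5
  have s3 : ∑ x, ∑ x', R3 x x' ≤ N * (10 * δ * N ^ 5) := by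
    refine five_c.trans ?_
    rw [hN] at h5 ⊢
    exact mul_le_mul_of_nonneg_left h5 (by positivity)
  have s4 : ∑ x, ∑ x', R4 x x' ≤ N * (10 * δ * N ^ 5) := by
    refine five_d.trans ?_
    rw [hN] at h5 ⊢
    exact mul_le_mul_of_nonneg_left h5 (by positivity)
  have hmle : ∀ x x', mm H V₃ V₄ x x' ≤ N ^ 2 := fun x x' => by rw [hN]; exact mm_le _ _ _ _
  exact select_aux (PP H ρ X Y) (mm H V₃ V₄) D R1 R2 R3 R4 hN0 hε hσ hδ hδ0 hδN hm
    (mm_nonneg V₃ V₄) hmle D0 R10 R20 R30 R40 s0 s1 s2 s3 s4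

end average
/-- typical `K₄⁻`-copies give many `(X,Y)`-bridges of length `c+1`
or many `(V₁,V₂)`-bridges of length 1. -/
theorem stmt_18 (c : ℕ) (hc : 0 < c) :
    ∃ ρ₀ : ℝ, 0 < ρ₀ ∧ ∀ ρ : ℝ, 0 < ρ → ρ ≤ ρ₀ →
      ∀ γ : ℝ, 0 < γ → γ ≤ ρ →
        ∃ η₀ : ℝ, 0 < η₀ ∧ ∀ η : ℝ, 0 < η → η ≤ η₀ →
          ∃ ε₀ : ℝ, 0 < ε₀ ∧ ∀ ε : ℝ, 0 < ε → ε ≤ ε₀ →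
            ∃ ε'₀ : ℝ, 0 < ε'₀ ∧ ∀ ε' : ℝ, 0 < ε' → ε' ≤ ε'₀ →
              ∃ n₀ : ℕ, ∀ n : ℕ, n₀ ≤ n →
                ∀ H : Finset (Finset (Fin n)), Is3Graph n H →
                  CodegLB H ((1 / 2 - γ) * n) →
                  ∀ X Y V₁ V₂ V₃ V₄ : Finset (Fin n),
                    Disjoint X Y → X ∪ Y = Finset.univ →
                    (1 / 2 - ρ) * n ≤ (X.card : ℝ) → (X.card : ℝ) ≤ (1 / 2 + ρ) * n →
                    X = V₁ ∪ V₂ → Y = V₃ ∪ V₄ →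
                    (V₁ = V₂ ∨ Disjoint V₁ V₂) → (V₃ = V₄ ∨ Disjoint V₃ V₄) →
                    (ClosedOn H c η V₁ ∧ (1 / 4 - 4 * γ) * n ≤ (V₁.card : ℝ)) →
                    (ClosedOn H c η V₂ ∧ (1 / 4 - 4 * γ) * n ≤ (V₂.card : ℝ)) →
                    (ClosedOn H c η V₃ ∧ (1 / 4 - 4 * γ) * n ≤ (V₃.card : ℝ)) →
                    (ClosedOn H c η V₄ ∧ (1 / 4 - 4 * γ) * n ≤ (V₄.card : ℝ)) →
                    ε * (n : ℝ) ^ 4 ≤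
                      ({S : Finset (Fin n) | ∃ x ∈ X, ∃ x' ∈ X, ∃ y ∈ V₃, ∃ y' ∈ V₄,
                        S = {x, x', y, y'} ∧ SpansK4m H S ∧
                        TypicalTriple H ρ X Y x x' y}.ncard : ℝ) →
                    (ε' * (n : ℝ) ^ (4 * c + 5) ≤ (BridgeCount H (c + 1) X Y : ℝ) ∨
                     (Disjoint V₁ V₂ ∧
                      ε' * (n : ℝ) ^ 5 ≤ (BridgeCount H 1 V₁ V₂ : ℝ))) := by
  refine ⟨1 / 1000000, by norm_num, fun ρ hρ hρ1 γ hγ hγρ => ⟨1, one_pos, fun η hη _ =>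
    ⟨1, one_pos, fun ε hε _ => ?_⟩⟩⟩
  set σ : ℝ := 1 / 1000000 with hσd
  have hσ : 0 < σ := by norm_num [hσd]
  set δ : ℝ := σ * ε / 50 with hδd
  have hδ : 0 < δ := by positivity
  have hC : (0 : ℝ) < (4 * c + 3 : ℝ) ^ 4 := by positivity
  refine ⟨δ * (η / 2) / (4 * c + 3 : ℝ) ^ 4, by positivity, fun ε' hε' hε'1 =>
    ⟨⌈1 / σ + 12 / η + 1 / δ + 100⌉₊, ?_⟩⟩
  intro n hn H h3 hd X Y V₁ V₂ V₃ V₄ hXY hU hX1 hX2 _ hY _ _ _ _ hV3 hV4 hcount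
  left
  by_contra hcon
  push Not at hcon
  have hn' : 1 / σ + 12 / η + 1 / δ + 100 ≤ (n : ℝ) := Nat.ceil_le.mp hn
  have g1 : 0 < 1 / σ := by positivity
  have g2 : 0 < 12 / η := by positivity
  have g3 : 0 < 1 / δ := by positivity
  obtain ⟨N, hN⟩ : ∃ N : ℝ, N = n := ⟨_, rfl⟩
  have hN0 : 0 < N := by rw [hN]; linarith
  have k1 : 1 ≤ σ * N := by
    have : 1 / σ ≤ N := by rw [hN]; linarith
    rwa [div_le_iff₀' hσ] at this
  have k2 : 12 ≤ η * (n : ℝ) := by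
    have : 12 / η ≤ (n : ℝ) := by linarith
    rwa [div_le_iff₀' hη] at this
  have k3 : 1 ≤ δ * N := by
    have : 1 / δ ≤ N := by rw [hN]; linarith
    rwa [div_le_iff₀' hδ] at this
  have k4 : 100 ≤ N := by rw [hN]; linarith
  have hV3Y : V₃ ⊆ Y := hY ▸ Finset.subset_union_left
  have hV4Y : V₄ ⊆ Y := hY ▸ Finset.subset_union_right
  -- the bound on the number of bridges
  set K : ℝ := η / 2 * (n : ℝ) ^ (4 * c - 1) with hK
  have hn0 : (0 : ℝ) < n := hN ▸ hN0
  have hK0 : 0 < K := by positivity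
  have hBC : (4 * c + 3 : ℝ) ^ 4 * BridgeCount H (c + 1) X Y ≤ δ * N ^ 6 * K := by
    have e : (n : ℝ) ^ (4 * c + 5) = (n : ℝ) ^ (4 * c - 1) * (n : ℝ) ^ 6 := by
      rw [← pow_add]; congr 1; omega
    rw [le_div_iff₀ hC] at hε'1
    have hp : (0 : ℝ) ≤ (n : ℝ) ^ (4 * c + 5) := by positivity
    calc (4 * c + 3 : ℝ) ^ 4 * BridgeCount H (c + 1) X Y
        ≤ (4 * c + 3 : ℝ) ^ 4 * (ε' * (n : ℝ) ^ (4 * c + 5)) :=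
          mul_le_mul_of_nonneg_left hcon.le hC.le
      _ = (ε' * (4 * c + 3 : ℝ) ^ 4) * (n : ℝ) ^ (4 * c + 5) := by ring
      _ ≤ (δ * (η / 2)) * (n : ℝ) ^ (4 * c + 5) := mul_le_mul_of_nonneg_right hε'1 hp
      _ = _ := by rw [e, hK, hN]; ring
  have b3 : ((Qsix H X Y V₃).card : ℝ) ≤ δ * N ^ 6 :=
    le_of_mul_le_mul_right ((qsix_bound hXY hc k2 hV3Y hV3.1).trans hBC) hK0
  have b4 : ((Qsix H X Y V₄).card : ℝ) ≤ δ * N ^ 6 :=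
    le_of_mul_le_mul_right ((qsix_bound hXY hc k2 hV4Y hV4.1).trans hBC) hK0
  have hγσ : γ ≤ σ := hγρ.trans hρ1
  have b5 : Qfive H X Y ≤ 10 * δ * N ^ 5 := by
    have hw : (n : ℝ) / 10 + 5 ≤ V₃.card := by
      refine le_trans ?_ hV3.2
      have : γ * n ≤ 1 / 1000000 * n := mul_le_mul_of_nonneg_right hγσ hn0.le
      rw [hN] at k4
      linarith
    have h1 := le_of_mul_le_mul_right
      ((qfive_bound (X := X) (Y := Y) hc hη k2 hV3.1 hw).trans hBC) hK0
    rw [← hN] at h1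
    refine le_of_mul_le_mul_right (?_ : _ * (N / 10) ≤ _) (show 0 < N / 10 by positivity)
    refine h1.trans (le_of_eq ?_)
    ring
  have hm : ε * N ^ 4 ≤ ∑ p ∈ PP H ρ X Y, mm H V₃ V₄ p.1 p.2 := by
    rw [hN]
    exact hcount.trans (typ_count ρ V₃ V₄)
  obtain ⟨p, hp, c1, c2, c3, c4, c5⟩ := select hY hN hN0 hε hσ
    (le_of_eq (by rw [hδd]; ring)) hδ k3 hm b5 b3 b4
  simp only [PP, Finset.mem_filter, Finset.mem_product] at hp
  have hρN : ρ * n ≤ σ * N := by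
    rw [hN]; exact mul_le_mul_of_nonneg_right hρ1 hn0.le
  have hγN : γ * n ≤ σ * N := by
    rw [hN]; exact mul_le_mul_of_nonneg_right hγσ hn0.le
  refine core h3 hXY hU hN hσ le_rfl k1 ?_ ?_ ?_ hp.1.1 hp.1.2
    ((t1_sum hp.2).trans hρN) c1 c2 c3 c4 c5
  · intro a b hab
    refine le_trans ?_ (hd a b hab)
    rw [sub_mul, sub_mul]
    rw [hN] at hγN ⊢
    exact sub_le_sub_left hγN _
  · refine hX2.trans ?_
    rw [add_mul, add_mul]
    rw [hN] at hρN ⊢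
    exact add_le_add_right hρN _
  · refine le_trans ?_ hX1
    rw [sub_mul, sub_mul]
    rw [hN] at hρN ⊢
    exact sub_le_sub_left hρN _
end
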